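/- arXiv:2602.11993 — 2 statements merged into one kernel-verified Lean document; each statement's English description precedes it below -/
import Mathlib

section
/- Let G be a simple grid graph whose vertex set is partitioned into two nonempty sets inducing connected subgraphs G_1 and G_2. Then there exists a vertex v ∈ V(G_1) that is not a cut vertex of G_1 and is adjacent in G to some vertex u ∈ V(G_2). -/
open SimpleGraph

/-- The square lattice graph on `ℤ × ℤ`: points at Euclidean distance 1 are adjacent. -/
def latticeGraph : SimpleGraph (ℤ × ℤ) :=
  SimpleGraph.fromRel (fun u v => (u.1 - v.1) ^ 2 + (u.2 - v.2) ^ 2 = 1)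

/-- Given a set `A` of lattice edges (thought of as the edges of a simple closed
lattice loop), the point `(q.1, q.2 + 1/2)` is interior to the loop iff the
horizontal ray from it to the right crosses an odd number of vertical loop
edges.  For `q ∉ loop`, this also decides whether the lattice point `q` itself
is interior, and whether the vertical lattice edge from `q` to `q + (0,1)` is
interior. -/
def vInterior (A : Set (Sym2 (ℤ × ℤ))) (q : ℤ × ℤ) : Prop :=
  Odd (Nat.card {x : ℤ // q.1 < x ∧ s(((x, q.2) : ℤ × ℤ), ((x, q.2 + 1) : ℤ × ℤ)) ∈ A})

/-- Whether the horizontal lattice edge from `q` to `q + (1,0)` is interior to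
the loop with edge set `A`: the vertical ray upwards from its midpoint crosses
an odd number of horizontal loop edges. -/
def hInterior (A : Set (Sym2 (ℤ × ℤ))) (q : ℤ × ℤ) : Prop :=
  Odd (Nat.card {y : ℤ // q.2 < y ∧ s(((q.1, y) : ℤ × ℤ), ((q.1 + 1, y) : ℤ × ℤ)) ∈ A})

/-- The lattice edge `{u, v}` lies on or interior to the loop with edge set `A`. -/
def edgeOK (A : Set (Sym2 (ℤ × ℤ))) (u v : ℤ × ℤ) : Prop :=
  s(u, v) ∈ A ∨
  (u.1 = v.1 ∧ vInterior A (u.1, min u.2 v.2)) ∨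
  (u.2 = v.2 ∧ hInterior A (min u.1 v.1, u.2))

/-- A simple grid graph, presented by a simple closed loop in the square
lattice: the data of a closed walk in `latticeGraph` that is a cycle. -/
structure SimpleGridGraph where
  /-- basepoint of the loop -/
  base : ℤ × ℤ
  /-- the boundary loop -/
  loop : latticeGraph.Walk base base
  /-- the loop is a simple closed loop (a cycle) -/
  isCycle : loop.IsCycle

/-- The set of edges of the boundary loop. -/
def SimpleGridGraph.loopEdges (Γ : SimpleGridGraph) : Set (Sym2 (ℤ × ℤ)) :=
  {e | e ∈ Γ.loop.edges}

/-- The boundary `∂G`: the vertices of the loop. -/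
def SimpleGridGraph.boundary (Γ : SimpleGridGraph) : Set (ℤ × ℤ) :=
  {v | v ∈ Γ.loop.support}

/-- The vertex set of the simple grid graph: all lattice points on or interior
to the boundary loop. -/
def SimpleGridGraph.verts (Γ : SimpleGridGraph) : Set (ℤ × ℤ) :=
  Γ.boundary ∪ {v | vInterior Γ.loopEdges v}

/-- The simple grid graph itself: its vertices are the lattice points on or
interior to the loop, and its edges are the lattice edges on or interior to
the loop. -/
def SimpleGridGraph.graph (Γ : SimpleGridGraph) : SimpleGraph ↥Γ.verts :=
  SimpleGraph.fromRel (fun u v => latticeGraph.Adj u.1 v.1 ∧ edgeOK Γ.loopEdges u.1 v.1)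


lemma lat_adj {u v : ℤ × ℤ} : latticeGraph.Adj u v ↔ (u.1 - v.1) ^ 2 + (u.2 - v.2) ^ 2 = 1 := by
  unfold latticeGraph
  rw [SimpleGraph.fromRel_adj]
  constructor
  · rintro ⟨_, h | h⟩
    · exact h
    · linarith
  · intro h
    refine ⟨?_, Or.inl h⟩
    rintro rfl
    simp at h

lemma lat_adj_cases {u v : ℤ × ℤ} (h : latticeGraph.Adj u v) :
    v = (u.1, u.2 + 1) ∨ v = (u.1, u.2 - 1) ∨ v = (u.1 + 1, u.2) ∨ v = (u.1 - 1, u.2) := by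
  rw [lat_adj] at h
  obtain ⟨a, b⟩ := u
  obtain ⟨c, d⟩ := v
  simp only [Prod.mk.injEq] at *
  have h1 : (a - c) ≤ 1 := by nlinarith [sq_nonneg (b - d)]
  have h2 : -1 ≤ (a - c) := by nlinarith [sq_nonneg (b - d)]
  have h3 : (b - d) ≤ 1 := by nlinarith [sq_nonneg (a - c)]
  have h4 : -1 ≤ (b - d) := by nlinarith [sq_nonneg (a - c)]
  generalize hp : a - c = p at *
  generalize hq : b - d = q at *
  interval_cases p <;> interval_cases q <;> first | omega | (exfalso; revert h; norm_num)

lemma lat_up (x y : ℤ) : latticeGraph.Adj (x, y) (x, y + 1) := by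
  rw [lat_adj]; ring

open Classical in
lemma even_deg (Γ : SimpleGridGraph) (x y : ℤ) :
    Even ((if s((x, y), (x, y+1)) ∈ Γ.loop.edges then 1 else 0)
      + (if s((x, y-1), (x, y)) ∈ Γ.loop.edges then 1 else 0)
      + (if s((x, y), (x+1, y)) ∈ Γ.loop.edges then 1 else 0)
      + (if s((x-1, y), (x, y)) ∈ Γ.loop.edges then 1 else 0)) := by
  have h := (Γ.isCycle.isTrail.even_countP_edges_iff (x, y)).2 (fun h => absurd rfl h)
  have hnd : Γ.loop.edges.Nodup := Γ.isCycle.isTrail.edges_nodup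
  rw [List.countP_eq_length_filter, ← List.toFinset_card_of_nodup (hnd.filter _)] at h
  have key : (List.filter (fun e => decide ((x, y) ∈ e)) Γ.loop.edges).toFinset
      = ({s((x, y), (x, y+1)), s((x, y-1), (x, y)), s((x, y), (x+1, y)), s((x-1, y), (x, y))} :
        Finset (Sym2 (ℤ × ℤ))).filter (fun e => e ∈ Γ.loop.edges) := by
    ext e
    simp only [List.mem_toFinset, List.mem_filter, decide_eq_true_eq, Finset.mem_filter,
      Finset.mem_insert, Finset.mem_singleton]
    constructor
    · rintro ⟨h1, h2⟩
      refine ⟨?_, h1⟩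
      obtain ⟨v, rfl⟩ := h2
      have := Γ.loop.adj_of_mem_edges h1
      rcases lat_adj_cases this with h | h | h | h <;> subst h <;> simp
    · rintro ⟨h1, h2⟩
      refine ⟨h2, ?_⟩
      rcases h1 with h | h | h | h <;> subst h <;> simp
  have h' : Even (({s((x, y), (x, y+1)), s((x, y-1), (x, y)), s((x, y), (x+1, y)),
      s((x-1, y), (x, y))} :
        Finset (Sym2 (ℤ × ℤ))).filter (fun e => e ∈ Γ.loop.edges)).card := by
    rw [← key]; convert h
  rw [Finset.card_filter, Finset.sum_insert, Finset.sum_insert, Finset.sum_insert,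
    Finset.sum_singleton] at h'
  · simpa only [add_assoc] using h'
  all_goals simp <;> omega

lemma exists_bound (l : List (ℤ × ℤ)) :
    ∃ M : ℤ, ∀ v ∈ l, v.1 < M ∧ v.2 < M ∧ -M < v.2 ∧ -M < v.1 := by
  induction l with
  | nil => exact ⟨0, by simp⟩
  | cons a l ih =>
    obtain ⟨M, hM⟩ := ih
    refine ⟨max M (|a.1| + |a.2| + 1), ?_⟩
    intro v hv
    rcases List.mem_cons.1 hv with rfl | hv
    · grind
    · have := hM v hv
      grind

open Classical in
noncomputable def cnt (Γ : SimpleGridGraph) (M x y : ℤ) : ℕ :=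
  ((Finset.Ioc x M).filter (fun t => s((t, y), (t, y+1)) ∈ Γ.loop.edges)).card

lemma vInt_iff (Γ : SimpleGridGraph) (M : ℤ) (hM : ∀ v ∈ Γ.loop.support, v.1 < M) (x y : ℤ) :
    vInterior Γ.loopEdges (x, y) ↔ Odd (cnt Γ M x y) := by
  classical
  unfold vInterior cnt
  rw [Nat.subtype_card]
  intro t
  simp only [Finset.mem_filter, Finset.mem_Ioc, SimpleGridGraph.loopEdges, Set.mem_setOf_eq]
  constructor
  · rintro ⟨⟨h1, _⟩, h2⟩
    exact ⟨h1, h2⟩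
  · rintro ⟨h1, h2⟩
    exact ⟨⟨h1, (hM _ (Γ.loop.fst_mem_support_of_mem_edges h2)).le⟩, h2⟩

open Classical in
lemma cnt_step (Γ : SimpleGridGraph) (M x y : ℤ) (h : x ≤ M) :
    cnt Γ M (x-1) y = cnt Γ M x y + (if s((x, y), (x, y+1)) ∈ Γ.loop.edges then 1 else 0) := by
  unfold cnt
  have : Finset.Ioc (x-1) M = insert x (Finset.Ioc x M) := by
    ext t; simp; omega
  rw [this, Finset.filter_insert]
  split_ifs
  · rw [Finset.card_insert_of_notMem (by simp)]
  · rfl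

open Classical in
lemma parity (Γ : SimpleGridGraph) (M : ℤ) (hM : ∀ v ∈ Γ.loop.support, v.1 < M) (y x : ℤ)
    (hx : x ≤ M) :
    Even (cnt Γ M x y + cnt Γ M x (y-1) +
      (if s((x, y), (x+1, y)) ∈ Γ.loop.edges then 1 else 0)) := by
  induction x, hx using Int.leInductionDown with
  | base =>
    rw [if_neg]
    · simp [cnt]
    · intro h
      have := hM _ (Γ.loop.fst_mem_support_of_mem_edges h)
      simp at this
  | pred x hx ih =>
    rw [cnt_step _ _ _ _ hx, cnt_step _ _ _ _ hx]
    have := even_deg Γ x y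
    rw [show x - 1 + 1 = x by ring, show y - 1 + 1 = y by ring]
    rw [Nat.even_iff] at *
    omega

lemma vInt_step (Γ : SimpleGridGraph) (x y : ℤ) (h : (x, y) ∉ Γ.loop.support) :
    vInterior Γ.loopEdges (x, y) ↔ vInterior Γ.loopEdges (x, y-1) := by
  classical
  obtain ⟨M, hM⟩ := exists_bound Γ.loop.support
  have hM' : ∀ v ∈ Γ.loop.support, v.1 < max M x := fun v hv => lt_max_of_lt_left (hM v hv).1
  rw [vInt_iff Γ _ hM', vInt_iff Γ _ hM']
  have := parity Γ _ hM' y x (le_max_right _ _)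
  rw [if_neg (fun h' => h (Γ.loop.fst_mem_support_of_mem_edges h'))] at this
  rw [Nat.even_iff] at this
  rw [Nat.odd_iff, Nat.odd_iff]
  omega

lemma vInt_edge (Γ : SimpleGridGraph) (x y : ℤ) (h : vInterior Γ.loopEdges (x, y)) :
    ∃ t, s(((t, y) : ℤ × ℤ), ((t, y + 1) : ℤ × ℤ)) ∈ Γ.loop.edges := by
  by_contra hc
  push Not at hc
  unfold vInterior at h
  have : IsEmpty {t : ℤ // x < t ∧ s(((t, y) : ℤ × ℤ), ((t, y + 1) : ℤ × ℤ)) ∈ Γ.loopEdges} :=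
    ⟨fun t => hc t.1 t.2.2⟩
  rw [Nat.card_of_isEmpty] at h
  simp at h

/-- closedness of a predicate along graph edges avoiding `c` -/
def ClosedOff (Γ : SimpleGridGraph) (c : ℤ × ℤ) (P : ℤ × ℤ → Prop) : Prop :=
  ∀ u v, u ∈ Γ.verts → v ∈ Γ.verts → u ≠ c → v ≠ c → latticeGraph.Adj u v →
    edgeOK Γ.loopEdges u v → (P u ↔ P v)

lemma vert_edgeOK (Γ : SimpleGridGraph) (x y : ℤ) (h : vInterior Γ.loopEdges (x, y)) :
    edgeOK Γ.loopEdges (x, y) (x, y+1) := by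
  refine Or.inr (Or.inl ⟨rfl, ?_⟩)
  simpa using h

lemma go_up (Γ : SimpleGridGraph) (c : ℤ × ℤ) (P : ℤ × ℤ → Prop) (hP : ClosedOff Γ c P)
    (M : ℤ) (hM : ∀ v ∈ Γ.loop.support, v.2 < M) (n : ℕ) :
    ∀ x y : ℤ, M - y ≤ n → (x, y) ∈ Γ.verts → (c.1 ≠ x ∨ c.2 < y) →
      ∃ l ∈ Γ.loop.support, l.1 = x ∧ l ≠ c ∧ (P (x, y) ↔ P l) := by
  induction n with
  | zero =>
    intro x y hn hv hc
    rcases hv with hv | hv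
    · exact ⟨(x, y), hv, rfl, by rintro rfl; simp at hc, Iff.rfl⟩
    · obtain ⟨t, ht⟩ := vInt_edge Γ x y hv
      have := hM _ (Γ.loop.fst_mem_support_of_mem_edges ht)
      simp at this hn
      omega
  | succ n ih =>
    intro x y hn hv hc
    by_cases hs : (x, y) ∈ Γ.loop.support
    · exact ⟨(x, y), hs, rfl, by rintro rfl; simp at hc, Iff.rfl⟩
    have hv0 := hv
    rcases hv with hv | hv
    · exact absurd hv hs
    have hv' : (x, y+1) ∈ Γ.verts := by
      by_cases hs' : (x, y+1) ∈ Γ.loop.support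
      · exact Or.inl hs'
      · right
        have := vInt_step Γ x (y+1) hs'
        rw [add_sub_cancel_right] at this
        exact this.2 hv
    obtain ⟨l, h1, h2, h3, h4⟩ := ih x (y+1) (by push_cast at hn; omega) hv' (by omega)
    refine ⟨l, h1, h2, h3, Iff.trans ?_ h4⟩
    refine hP _ _ hv0 hv' ?_ ?_ (lat_up x y) (vert_edgeOK Γ x y hv)
    · rintro rfl; simp at hc
    · rintro rfl; simp at hc

lemma go_down (Γ : SimpleGridGraph) (c : ℤ × ℤ) (P : ℤ × ℤ → Prop) (hP : ClosedOff Γ c P)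
    (M : ℤ) (hM : ∀ v ∈ Γ.loop.support, M < v.2) (n : ℕ) :
    ∀ x y : ℤ, y - M ≤ n → (x, y) ∈ Γ.verts → (c.1 ≠ x ∨ y < c.2) →
      ∃ l ∈ Γ.loop.support, l ≠ c ∧ (P (x, y) ↔ P l) := by
  induction n with
  | zero =>
    intro x y hn hv hc
    rcases hv with hv | hv
    · exact ⟨(x, y), hv, by rintro rfl; simp at hc, Iff.rfl⟩
    · obtain ⟨t, ht⟩ := vInt_edge Γ x y hv
      have := hM _ (Γ.loop.fst_mem_support_of_mem_edges ht)
      simp at this hn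
      omega
  | succ n ih =>
    intro x y hn hv hc
    by_cases hs : (x, y) ∈ Γ.loop.support
    · exact ⟨(x, y), hs, by rintro rfl; simp at hc, Iff.rfl⟩
    have hv0 := hv
    rcases hv with hv | hv
    · exact absurd hv hs
    have hi := (vInt_step Γ x y hs).1 hv
    have hv' : (x, y-1) ∈ Γ.verts := Or.inr hi
    obtain ⟨l, h1, h3, h4⟩ := ih x (y-1) (by push_cast at hn; omega) hv' (by omega)
    refine ⟨l, h1, h3, Iff.trans ?_ h4⟩
    have e1 := lat_up x (y-1)
    have e2 := vert_edgeOK Γ x (y-1) hi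
    rw [sub_add_cancel] at e1 e2
    refine (hP _ _ hv' hv0 ?_ ?_ e1 e2).symm
    · rintro rfl; simp at hc; omega
    · rintro rfl; simp at hc

lemma walk_closed (Γ : SimpleGridGraph) (c : ℤ × ℤ) (P : ℤ × ℤ → Prop) (hP : ClosedOff Γ c P)
    {u v : ℤ × ℤ} (p : latticeGraph.Walk u v) (hs : ∀ z ∈ p.support, z ∈ Γ.loop.support ∧ z ≠ c)
    (he : ∀ e ∈ p.edges, e ∈ Γ.loop.edges) : ∀ z ∈ p.support, (P u ↔ P z) := by
  induction p with
  | nil => simp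
  | @cons a b d h p ih =>
    have ih' := ih (fun z hz => hs z (by simp [hz])) (fun e h => he e (by simp [h]))
    intro z hz
    rw [Walk.support_cons, List.mem_cons] at hz
    rcases hz with rfl | hz
    · rfl
    · refine Iff.trans ?_ (ih' z hz)
      have ha := hs a (by simp)
      have hb := hs b (by simp)
      exact hP a b (Or.inl ha.1) (Or.inl hb.1) ha.2 hb.2 h (Or.inl (he _ (by simp)))

lemma loop_closed (Γ : SimpleGridGraph) (c : ℤ × ℤ) (P : ℤ × ℤ → Prop) (hP : ClosedOff Γ c P)
    (u v : ℤ × ℤ) (hu : u ∈ Γ.loop.support) (hv : v ∈ Γ.loop.support) (huc : u ≠ c)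
    (hvc : v ≠ c) : P u ↔ P v := by
  classical
  by_cases hc : c ∈ Γ.loop.support
  · have hcyc := Γ.isCycle.rotate hc
    have hsup : ∀ z, z ∈ (Γ.loop.rotate c hc).support ↔ z ∈ Γ.loop.support := by
      intro z
      exact Walk.mem_support_rotate_iff _ c hc
    have hed : ∀ z, z ∈ (Γ.loop.rotate c hc).edges ↔ z ∈ Γ.loop.edges := by
      intro z
      exact (Γ.loop.rotate_edges c hc).mem_iff
    generalize Γ.loop.rotate c hc = p at *
    cases p with
    | nil => exact absurd rfl hcyc.ne_nil
    | @cons _ b _ h q =>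
      have hq := ((Walk.cons_isCycle_iff q h).1 hcyc).1.reverse
      have hs2 : ∀ z, z ∈ q.reverse.support ↔ z ∈ q.support := by simp
      have he2 : ∀ z, z ∈ q.reverse.edges ↔ z ∈ q.edges := by simp
      generalize q.reverse = r at *
      cases r with
      | nil => exact absurd h (by simp)
      | @cons _ d _ h' r =>
        rw [Walk.cons_isPath_iff] at hq
        have hmem : ∀ z, z ∈ Γ.loop.support → z ≠ c → z ∈ r.support := by
          intro z hz hzc
          rw [← hsup, Walk.support_cons, List.mem_cons, ← hs2, Walk.support_cons,
            List.mem_cons] at hz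
          tauto
        have := walk_closed Γ c P hP r (fun z hz => ⟨(hsup z).1 (by
            rw [Walk.support_cons, List.mem_cons, ← hs2, Walk.support_cons, List.mem_cons]
            tauto), by rintro rfl; exact hq.2 hz⟩) (fun e h => (hed e).1 (by
              rw [Walk.edges_cons, List.mem_cons, ← he2, Walk.edges_cons, List.mem_cons]
              tauto))
        exact (this u (hmem u hu huc)).symm.trans (this v (hmem v hv hvc))
  · have := walk_closed Γ c P hP Γ.loop (fun z hz => ⟨hz, by rintro rfl; exact hc hz⟩)
      (fun e h => h)
    exact (this u hu).symm.trans (this v hv)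

lemma two_conn (Γ : SimpleGridGraph) (c : ℤ × ℤ) (P : ℤ × ℤ → Prop) (hP : ClosedOff Γ c P)
    (u v : ℤ × ℤ) (hu : u ∈ Γ.verts) (hv : v ∈ Γ.verts) (huc : u ≠ c) (hvc : v ≠ c) :
    P u ↔ P v := by
  obtain ⟨M, hM⟩ := exists_bound Γ.loop.support
  have key : ∀ u : ℤ × ℤ, u ∈ Γ.verts → u ≠ c → ∃ l ∈ Γ.loop.support, l ≠ c ∧ (P u ↔ P l) := by
    rintro ⟨x, y⟩ hu huc
    by_cases h : c.1 ≠ x ∨ c.2 < y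
    · obtain ⟨l, h1, -, h2⟩ := go_up Γ c P hP M (fun v hv => (hM v hv).2.1) (M - y).toNat x y
        (by omega) hu h
      exact ⟨l, h1, h2⟩
    · refine go_down Γ c P hP (-M) (fun v hv => (hM v hv).2.2.1) (y + M).toNat x y
        (by omega) hu ?_
      right
      push Not at h
      refine lt_of_le_of_ne h.2 ?_
      rintro rfl
      exact huc (by rw [← h.1])
  obtain ⟨a, ha, hac, h1⟩ := key u hu huc
  obtain ⟨b, hb, hbc, h2⟩ := key v hv hvc
  exact h1.trans ((loop_closed Γ c P hP a b ha hb hac hbc).trans h2.symm)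

lemma verts_finite (Γ : SimpleGridGraph) : Γ.verts.Finite := by
  obtain ⟨M, hM⟩ := exists_bound Γ.loop.support
  refine (Set.finite_Icc ((-M, -M) : ℤ × ℤ) (M, M)).subset ?_
  rintro ⟨x, y⟩ hq
  obtain ⟨l, h1, h2, -⟩ := go_up Γ (x, y-1) (fun _ => True) (fun _ _ _ _ _ _ _ _ => Iff.rfl) M
    (fun v hv => (hM v hv).2.1) (M - y).toNat x y (by omega) hq (Or.inr (by simp))
  have hl := hM l h1
  have hy : -M < y ∧ y < M := by
    rcases hq with hq | hq
    · exact ⟨(hM _ hq).2.2.1, (hM _ hq).2.1⟩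
    · obtain ⟨t, ht⟩ := vInt_edge Γ x y hq
      have := hM _ (Γ.loop.fst_mem_support_of_mem_edges ht)
      exact ⟨this.2.2.1, this.2.1⟩
  simp only [Set.mem_Icc, Prod.mk_le_mk]
  omega

lemma walk_avoid {V : Type*} (G : SimpleGraph V) (A : Set V) (w : V) {a b : A}
    (p : (G.induce A).Walk a b) (hp : ∀ z ∈ p.support, (z : V) ≠ w) :
    ∃ (ha : (a : V) ∈ A \ {w}) (hb : (b : V) ∈ A \ {w}),
      (G.induce (A \ {w})).Reachable ⟨a, ha⟩ ⟨b, hb⟩ := by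
  induction p with
  | @nil u => exact ⟨⟨u.2, hp u (by simp)⟩, ⟨u.2, hp u (by simp)⟩, Reachable.refl _⟩
  | @cons a b d h p ih =>
    obtain ⟨hb, hd, hr⟩ := ih (fun z hz => hp z (by simp [hz]))
    have ha : (a : V) ∈ A \ {w} := ⟨a.2, hp a (by simp)⟩
    refine ⟨ha, hd, Reachable.trans (Adj.reachable ?_) hr⟩
    exact h

lemma graph_adj (Γ : SimpleGridGraph) (u v : Γ.verts) (h : latticeGraph.Adj u.1 v.1)
    (h2 : edgeOK Γ.loopEdges u.1 v.1) : Γ.graph.Adj u v := by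
  unfold SimpleGridGraph.graph
  rw [SimpleGraph.fromRel_adj]
  refine ⟨?_, Or.inl ⟨h, h2⟩⟩
  rintro rfl
  exact h.ne rfl

/-- Two-connectivity, in crossing-edge form. -/
lemma exists_cross (Γ : SimpleGridGraph) (c : ℤ × ℤ) (K : Set Γ.verts) (a b : Γ.verts)
    (ha : a ∈ K) (hb : b ∉ K) (hac : a.1 ≠ c) (hbc : b.1 ≠ c) :
    ∃ u ∈ K, ∃ v ∉ K, u.1 ≠ c ∧ v.1 ≠ c ∧ Γ.graph.Adj u v := by
  by_contra hcon
  push Not at hcon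
  have hP : ClosedOff Γ c (fun p => ∃ hp : p ∈ Γ.verts, (⟨p, hp⟩ : Γ.verts) ∈ K) := by
    intro u v hu hv huc hvc h1 h2
    have hadj := graph_adj Γ ⟨u, hu⟩ ⟨v, hv⟩ h1 h2
    constructor
    · rintro ⟨_, h⟩
      refine ⟨hv, ?_⟩
      by_contra hn
      exact hcon _ h _ hn huc hvc hadj
    · rintro ⟨_, h⟩
      refine ⟨hu, ?_⟩
      by_contra hn
      exact hcon _ h _ hn hvc huc hadj.symm
  obtain ⟨_, h⟩ := (two_conn Γ c _ hP a b a.2 b.2 hac hbc).1 ⟨a.2, ha⟩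
  exact hb h

theorem stmt8 (Γ : SimpleGridGraph) (A : Set ↥Γ.verts)
    (hA : A.Nonempty) (hAc : Aᶜ.Nonempty)
    (h1 : (Γ.graph.induce A).Connected) (h2 : (Γ.graph.induce Aᶜ).Connected) :
    ∃ v ∈ A, (Γ.graph.induce (A \ {v})).Preconnected ∧
      ∃ u ∈ Aᶜ, Γ.graph.Adj v u := by
  classical
  obtain ⟨r, hr⟩ := hA
  obtain ⟨u0, hu0⟩ := hAc
  have : Finite Γ.verts := verts_finite Γ
  let S : Set A := {w | ∃ u ∈ Aᶜ, Γ.graph.Adj w.1 u}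
  have hS : S.Nonempty := by
    obtain ⟨c, hc⟩ := (verts_finite Γ).exists_notMem
    obtain ⟨u, hu, v, hv, -, -, h⟩ := exists_cross Γ c A r u0 hr hu0
      (fun h => hc (h ▸ r.2)) (fun h => hc (h ▸ u0.2))
    exact ⟨⟨u, hu⟩, v, hv, h⟩
  obtain ⟨w, hwS, hmax⟩ := Set.exists_max_image S (fun w => (Γ.graph.induce A).dist ⟨r, hr⟩ w)
    (Set.toFinite S) hS
  refine ⟨w.1, w.2, ?_, hwS⟩
  by_contra hnp
  have hk : ∃ k : ↥(A \ {w.1}), ∀ h : r ∈ A \ {w.1},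
      ¬ (Γ.graph.induce (A \ {w.1})).Reachable k ⟨r, h⟩ := by
    by_contra hcon
    push Not at hcon
    apply hnp
    intro x y
    obtain ⟨h, hx⟩ := hcon x
    obtain ⟨_, hy⟩ := hcon y
    exact hx.trans hy.symm
  obtain ⟨k, hk⟩ := hk
  obtain ⟨u, ⟨huA, hur⟩, v, hv, huw, hvw, hadj⟩ := exists_cross Γ w.1.1
    {p | ∃ h : p ∈ A \ {w.1}, (Γ.graph.induce (A \ {w.1})).Reachable k ⟨p, h⟩} k.1 u0
    ⟨k.2, Reachable.refl _⟩ (fun ⟨h, _⟩ => hu0 h.1)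
    (fun h => k.2.2 (Subtype.ext h)) (fun h => hu0 ((Subtype.ext h : u0 = w.1) ▸ w.2))
  have hvA : v ∈ Aᶜ := by
    intro hvA
    have hvA' : v ∈ A \ {w.1} := ⟨hvA, fun h => hvw (congrArg Subtype.val h)⟩
    refine hv ⟨hvA', hur.trans (Adj.reachable ?_)⟩
    exact hadj
  have hle := hmax ⟨u, huA.1⟩ ⟨v, hvA, hadj⟩
  obtain ⟨p, hp⟩ := h1.exists_walk_length_eq_dist ⟨r, hr⟩ ⟨u, huA.1⟩
  by_cases hw : w ∈ p.support
  · have e1 := SimpleGraph.dist_le (p.takeUntil w hw)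
    have e2 := congrArg Walk.length (p.take_spec hw)
    rw [Walk.length_append] at e2
    have e3 : (p.dropUntil w hw).length ≠ 0 := by
      intro h0
      have := Walk.eq_of_length_eq_zero h0
      exact huw (by rw [this])
    omega
  · obtain ⟨ha, hb, hreach⟩ := walk_avoid Γ.graph A w.1 p
      (fun z hz h => hw ((Subtype.ext h : z = w) ▸ hz))
    exact hk ha (hur.trans hreach.symm)
end

section
/- There exists a constant C > 0 such that for every simple grid graph G with n vertices, all a, b with a + b = n, and every T ∈ B_2^{a,b}(G), at most C·n BUD steps on B_2^{a,b}(G) transform T into a tree T' ∈ B_2^{a,b}(G) such that each of the two subtrees of T' (of sizes a and b, obtained by removing its split edge) contains a vertex of the boundary ∂G. -/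
open SimpleGraph

/-- `T ∈ B_2^{a,b}(G)`: `T` is a spanning tree of `G` containing an edge whose
removal splits it into two subtrees, on vertex sets `A` and `Aᶜ`, of sizes `a`
and `b` respectively. -/
def MemB2 {V : Type*} (G : SimpleGraph V) (a b : ℕ) (T : SimpleGraph V) : Prop :=
  T ≤ G ∧ T.IsTree ∧ ∃ g ∈ T.edgeSet, ∃ A : Set V,
    (∀ v w : V, (T.deleteEdges {g}).Reachable v w ↔ (v ∈ A ↔ w ∈ A)) ∧
    Nat.card ↥A = a ∧ Nat.card ↥(Aᶜ) = b

/-- A step of the BUD walk on `B_2^{a,b}(G)`: add an edge `e ∈ E(G) \ E(T)`,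
then remove an edge `f` of the resulting unique cycle (equivalently, an edge
whose removal leaves a tree), so that the result is again in `B_2^{a,b}(G)`. -/
def BUDStep2 {V : Type*} (G : SimpleGraph V) (a b : ℕ) (T T' : SimpleGraph V) : Prop :=
  MemB2 G a b T ∧ MemB2 G a b T' ∧
  ∃ e ∈ G.edgeSet \ T.edgeSet, ∃ f ∈ (T ⊔ SimpleGraph.fromEdgeSet {e}).edgeSet,
    T' = (T ⊔ SimpleGraph.fromEdgeSet {e}).deleteEdges {f}

namespace BudAux

/-- cut form of connectivity of a vertex set -/
def Cn {V : Type*} (T : SimpleGraph V) (S : Set V) : Prop :=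
  ∀ X : Set V, (∃ u ∈ S, u ∈ X) → (∃ v ∈ S, v ∉ X) →
    ∃ u ∈ S, ∃ v ∈ S, u ∈ X ∧ v ∉ X ∧ T.Adj u v

section
variable {V : Type*}

theorem Cn.singleton (T : SimpleGraph V) (v : V) : Cn T {v} := by
  rintro X ⟨u, hu, hX⟩ ⟨w, hw, hX'⟩
  simp only [Set.mem_singleton_iff] at hu hw
  subst hu; subst hw; exact absurd hX hX'

theorem Cn.congr {T T' : SimpleGraph V} {S : Set V} (h : Cn T S)
    (h' : ∀ u ∈ S, ∀ v ∈ S, T.Adj u v → T'.Adj u v) : Cn T' S := by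
  intro X h1 h2
  obtain ⟨u, hu, v, hv, a, b, c⟩ := h X h1 h2
  exact ⟨u, hu, v, hv, a, b, h' u hu v hv c⟩

theorem Cn.union {T : SimpleGraph V} {S S' : Set V} (h : Cn T S) (h' : Cn T S')
    {s s' : V} (hs : s ∈ S) (hs' : s' ∈ S') (ha : T.Adj s s') : Cn T (S ∪ S') := by
  rintro X ⟨u, hu, huX⟩ ⟨v, hv, hvX⟩
  by_cases h1 : (∃ u ∈ S, u ∈ X) ∧ (∃ v ∈ S, v ∉ X)
  · obtain ⟨u, hu, v, hv, a, b, c⟩ := h X h1.1 h1.2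
    exact ⟨u, Or.inl hu, v, Or.inl hv, a, b, c⟩
  by_cases h2 : (∃ u ∈ S', u ∈ X) ∧ (∃ v ∈ S', v ∉ X)
  · obtain ⟨u, hu, v, hv, a, b, c⟩ := h' X h2.1 h2.2
    exact ⟨u, Or.inr hu, v, Or.inr hv, a, b, c⟩
  by_cases h3 : s ∈ X <;> by_cases h4 : s' ∈ X
  · rcases hv with hv | hv
    · exact absurd ⟨⟨s, hs, h3⟩, ⟨v, hv, hvX⟩⟩ h1
    · exact absurd ⟨⟨s', hs', h4⟩, ⟨v, hv, hvX⟩⟩ h2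
  · exact ⟨s, Or.inl hs, s', Or.inr hs', h3, h4, ha⟩
  · exact ⟨s', Or.inr hs', s, Or.inl hs, h4, h3, ha.symm⟩
  · rcases hu with hu | hu
    · exact absurd ⟨⟨u, hu, huX⟩, ⟨s, hs, h3⟩⟩ h1
    · exact absurd ⟨⟨u, hu, huX⟩, ⟨s', hs', h4⟩⟩ h2

theorem Cn.insert' {T : SimpleGraph V} {S : Set V} (h : Cn T S)
    {s v : V} (hs : s ∈ S) (ha : T.Adj s v) : Cn T (insert v S) := by
  rw [Set.insert_eq, Set.union_comm]
  exact h.union (Cn.singleton T v) hs rfl ha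

theorem Cn.preconnected {T : SimpleGraph V} (h : Cn T Set.univ) : T.Preconnected := by
  intro u v
  by_contra hn
  obtain ⟨a, -, b, -, ha, hb, hab⟩ := h {w | T.Reachable u w} ⟨u, trivial, Reachable.refl u⟩
    ⟨v, trivial, hn⟩
  exact hb (Reachable.trans ha hab.reachable)

/-- closedness: no edges leave `Q` inside `S` -/
theorem Cn.subset_of_closed {T : SimpleGraph V} {S Q R : Set V} (hR : Cn T R) (hRS : R ⊆ S)
    (hcl : ∀ u ∈ Q, ∀ v ∈ S, T.Adj u v → v ∈ Q) {p : V} (hp : p ∈ R) (hpQ : p ∈ Q) : R ⊆ Q := by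
  intro r hr
  by_contra hn
  obtain ⟨a, -, b, hb, ha, hb', hab⟩ := hR Q ⟨p, hp, hpQ⟩ ⟨r, hr, hn⟩
  exact hb' (hcl a ha b (hRS hb) hab)

theorem exists_comp [Finite V] (T : SimpleGraph V) (S : Set V) {p : V} (hp : p ∈ S) :
    ∃ Q ⊆ S, p ∈ Q ∧ Cn T Q ∧ ∀ u ∈ Q, ∀ v ∈ S, T.Adj u v → v ∈ Q := by
  have hfin : {Q : Set V | Q ⊆ S ∧ p ∈ Q ∧ Cn T Q}.Finite := Set.toFinite _
  obtain ⟨Q, hQ⟩ := hfin.exists_maximal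
    ⟨{p}, by simpa using hp, rfl, Cn.singleton T p⟩
  obtain ⟨⟨hQS, hpQ, hc⟩, hmax⟩ := hQ
  refine ⟨Q, hQS, hpQ, hc, ?_⟩
  intro u hu v hv ha
  have := hmax (y := insert v Q) ⟨Set.insert_subset hv hQS, Or.inr hpQ, hc.insert' hu ha⟩
    (Set.subset_insert _ _)
  exact this (Or.inl rfl)

theorem exists_release [Finite V] {G : SimpleGraph V} (h2 : ∀ v, Cn G {v}ᶜ) {B : Set V}
    (hB : Cn G B) {p : V} (hp : p ∈ B) (hne : ∃ q ∈ B, q ≠ p) (hA : ∃ c, c ∉ B) :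
    ∃ y ∈ B, y ≠ p ∧ Cn G (B \ {y}) ∧ ∃ c, c ∉ B ∧ G.Adj y c := by
  let F : Set (Set V) := {Q | ∃ v ∈ B, v ≠ p ∧ (∃ c, c ∉ B ∧ G.Adj v c) ∧ Q ⊆ B \ {v} ∧ p ∈ Q ∧
    Cn G Q ∧ ∀ u ∈ Q, ∀ w ∈ B \ {v}, G.Adj u w → w ∈ Q}
  have hF : F.Nonempty := by
    obtain ⟨q, hq, hqp⟩ := hne
    obtain ⟨c, hc⟩ := hA
    obtain ⟨v, hv, w, -, hvB, hwB, hvw⟩ := h2 p B ⟨q, hqp, hq⟩ ⟨c, by rintro rfl; exact hc hp, hc⟩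
    obtain ⟨Q, a, b, c, d⟩ := exists_comp G (B \ {v}) (p := p) ⟨hp, fun h => hv h.symm⟩
    exact ⟨Q, v, hvB, hv, ⟨w, hwB, hvw⟩, a, b, c, d⟩
  obtain ⟨Q, ⟨v, hvB, hvp, hvA, hQ, hpQ, hcQ, hcl⟩, hmax⟩ := (Set.toFinite F).exists_maximal hF
  refine ⟨v, hvB, hvp, ?_, hvA⟩
  by_cases hS : B \ {v} ⊆ Q
  · rw [← hQ.antisymm hS]; exact hcQ
  exfalso
  obtain ⟨s, hs, hsQ⟩ := Set.not_subset.1 hS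
  obtain ⟨c, hc⟩ := hA
  obtain ⟨w, hwv, z, hzv, hw, hz, hwz⟩ := h2 v ((B \ {v}) \ Q) ⟨s, hs.2, hs, hsQ⟩
    ⟨c, by rintro rfl; exact hc hvB, fun h => hc h.1.1⟩
  have hzB : z ∉ B := by
    intro hzB
    have hzQ : z ∈ Q := by
      by_contra h; exact hz ⟨⟨hzB, hzv⟩, h⟩
    exact hw.2 (hcl z hzQ w hw.1 hwz.symm)
  have hwp : w ≠ p := by rintro rfl; exact hw.2 hpQ
  obtain ⟨Q', a, b, c', d⟩ := exists_comp G (B \ {w}) (p := p) ⟨hp, fun h => hwp h.symm⟩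
  have hvQ : v ∉ Q := fun h => (hQ h).2 rfl
  obtain ⟨q, hq, v', hv', hqQ, hv'Q, hqv⟩ := hB Q ⟨p, hp, hpQ⟩ ⟨v, hvB, hvQ⟩
  have hv'v : v' = v := by
    by_contra h
    exact hv'Q (hcl q hqQ v' ⟨hv', h⟩ hqv)
  subst hv'v
  have hins := hcQ.insert' hqQ hqv
  have hsub : insert v' Q ⊆ Q' := by
    refine hins.subset_of_closed (S := B \ {w}) ?_ d (Or.inr hpQ) b
    refine Set.insert_subset ⟨hvB, fun h => hwv h.symm⟩ ?_
    intro t ht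
    exact ⟨(hQ ht).1, by rintro rfl; exact hw.2 ht⟩
  have := hmax (y := Q') ⟨w, hw.1.1, hwp, ⟨z, hzB, hwz⟩, a, b, c', d⟩
    (fun t ht => hsub (Or.inr ht))
  exact hvQ (this (hsub (Or.inl rfl)))

/-- A spanning tree of `G` in which `B` and its complement are connected. -/
structure Resp (G T : SimpleGraph V) (B : Set V) : Prop where
  le : T ≤ G
  cB : Cn T B
  cA : Cn T Bᶜ
  cross : ∃ u ∈ B, ∃ v, v ∉ B ∧ T.Adj u v
  card : T.edgeSet.ncard + 1 = Nat.card V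

theorem Resp.compl {G T : SimpleGraph V} {B : Set V} (h : Resp G T B) : Resp G T Bᶜ := by
  refine ⟨h.le, h.cA, by simpa using h.cB, ?_, h.card⟩
  obtain ⟨u, hu, v, hv, ha⟩ := h.cross
  exact ⟨v, hv, u, fun h => h hu, ha.symm⟩

theorem Cn.univ_of {T : SimpleGraph V} {B : Set V} (h : Cn T B) (h' : Cn T Bᶜ)
    {u v : V} (hu : u ∈ B) (hv : v ∉ B) (ha : T.Adj u v) : Cn T Set.univ := by
  rw [← Set.union_compl_self B]
  exact h.union h' hu hv ha

theorem Resp.isTree [Finite V] {G T : SimpleGraph V} {B : Set V} (h : Resp G T B) : T.IsTree := by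
  obtain ⟨u, hu, v, hv, ha⟩ := h.cross
  rw [isTree_iff_connected_and_card]
  have : Nonempty V := ⟨u⟩
  exact ⟨⟨(h.cB.univ_of h.cA hu hv ha).preconnected⟩, h.card⟩

theorem Resp.cross_unique [Finite V] {G T : SimpleGraph V} {B : Set V} (h : Resp G T B)
    {u v u' v' : V} (hu : u ∈ B) (hv : v ∉ B) (ha : T.Adj u v)
    (hu' : u' ∈ B) (hv' : v' ∉ B) (ha' : T.Adj u' v') : u = u' ∧ v = v' := by
  by_contra hne
  have hne' : s(u', v') ≠ s(u, v) := by
    intro he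
    rw [Sym2.eq_iff] at he
    rcases he with ⟨rfl, rfl⟩ | ⟨rfl, rfl⟩
    · exact hne ⟨rfl, rfl⟩
    · exact hv hu'
  have hk : Cn (T.deleteEdges {s(u, v)}) Set.univ := by
    refine Cn.univ_of (B := B) (h.cB.congr ?_) (h.cA.congr ?_) hu' hv' ?_
    · intro x hx y hy hxy
      rw [deleteEdges_adj]
      refine ⟨hxy, ?_⟩
      simp only [Set.mem_singleton_iff, Sym2.eq_iff]
      rintro (⟨rfl, rfl⟩ | ⟨rfl, rfl⟩)
      · exact hv hy
      · exact hv hx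
    · intro x hx y hy hxy
      rw [deleteEdges_adj]
      refine ⟨hxy, ?_⟩
      simp only [Set.mem_singleton_iff, Sym2.eq_iff]
      rintro (⟨rfl, rfl⟩ | ⟨rfl, rfl⟩)
      · exact hx hu
      · exact hy hu
    · rw [deleteEdges_adj]; exact ⟨ha', by simpa using hne'⟩
  have hb := isAcyclic_iff_forall_adj_isBridge.1 h.isTree.isAcyclic ha
  rw [isBridge_iff] at hb
  exact hb (hk.preconnected u v)

theorem Resp.reach_iff [Finite V] {G T : SimpleGraph V} {B : Set V} (h : Resp G T B)
    {u v : V} (hu : u ∈ B) (hv : v ∉ B) (ha : T.Adj u v) (x y : V) :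
    (T.deleteEdges {s(u, v)}).Reachable x y ↔ (x ∈ B ↔ y ∈ B) := by
  have key : ∀ x y, (T.deleteEdges {s(u, v)}).Adj x y → (x ∈ B ↔ y ∈ B) := by
    intro x y hxy
    rw [deleteEdges_adj] at hxy
    obtain ⟨h1, h3⟩ := hxy
    simp only [Set.mem_singleton_iff, Sym2.eq_iff] at h3
    constructor
    · intro hx
      by_contra hy
      obtain ⟨rfl, rfl⟩ := h.cross_unique hu hv ha hx hy h1
      exact h3 (Or.inl ⟨rfl, rfl⟩)
    · intro hy
      by_contra hx
      obtain ⟨rfl, rfl⟩ := h.cross_unique hu hv ha hy hx h1.symm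
      exact h3 (Or.inr ⟨rfl, rfl⟩)
  constructor
  · rintro ⟨w⟩
    induction w with
    | nil => exact Iff.rfl
    | cons hab _ ih => exact (key _ _ hab).trans ih
  · have hin : ∀ S : Set V, (S = B ∨ S = Bᶜ) → Cn T S → x ∈ S → y ∈ S →
        (T.deleteEdges {s(u, v)}).Reachable x y := by
      intro S hS hC hx hy
      by_contra hn
      obtain ⟨a, haS, b, hbS, ha', hb', hab⟩ := hC {w | (T.deleteEdges {s(u, v)}).Reachable x w}
        ⟨x, hx, Reachable.refl x⟩ ⟨y, hy, hn⟩
      apply hb'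
      refine Reachable.trans ha' (Adj.reachable ?_)
      rw [deleteEdges_adj]
      refine ⟨hab, ?_⟩
      simp only [Set.mem_singleton_iff, Sym2.eq_iff]
      rcases hS with rfl | rfl
      · rintro (⟨rfl, rfl⟩ | ⟨rfl, rfl⟩)
        · exact hv hbS
        · exact hv haS
      · rintro (⟨rfl, rfl⟩ | ⟨rfl, rfl⟩)
        · exact haS hu
        · exact hbS hu
    intro hxy
    by_cases hx : x ∈ B
    · exact hin B (Or.inl rfl) h.cB hx (hxy.1 hx)
    · exact hin Bᶜ (Or.inr rfl) h.cA hx (fun hy => hx (hxy.2 hy))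

theorem Resp.memB2 [Finite V] {G T : SimpleGraph V} {B : Set V} (h : Resp G T B) :
    MemB2 G B.ncard Bᶜ.ncard T := by
  obtain ⟨u, hu, v, hv, ha⟩ := h.cross
  exact ⟨h.le, h.isTree, s(u, v), ha, B, h.reach_iff hu hv ha, rfl, rfl⟩

theorem Resp.of_split [Finite V] {G T : SimpleGraph V} (hle : T ≤ G) (ht : T.IsTree) {g : Sym2 V}
    (hg : g ∈ T.edgeSet) {A : Set V}
    (hA : ∀ v w : V, (T.deleteEdges {g}).Reachable v w ↔ (v ∈ A ↔ w ∈ A)) : Resp G T A := by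
  have hin : ∀ S : Set V, (∀ v w : V, (T.deleteEdges {g}).Reachable v w ↔ (v ∈ S ↔ w ∈ S)) →
      Cn T S := by
    classical
    rintro S hS X ⟨u, hu, huX⟩ ⟨v, hv, hvX⟩
    obtain ⟨w⟩ := (hS u v).2 (by tauto)
    obtain ⟨d, hd, h1, h2⟩ := w.exists_boundary_dart X huX hvX
    have hmem : ∀ z ∈ w.support, z ∈ S := by
      intro z hz
      exact ((hS u z).1 ⟨w.takeUntil z hz⟩).1 hu
    refine ⟨d.fst, hmem _ (w.dart_fst_mem_support_of_mem_darts hd), d.snd,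
      hmem _ (w.dart_snd_mem_support_of_mem_darts hd), h1, h2, ?_⟩
    exact (deleteEdges_le _) d.adj
  refine ⟨hle, hin A hA, hin Aᶜ ?_, ?_, ?_⟩
  · intro v w
    rw [hA v w]; simp only [Set.mem_compl_iff]; tauto
  · induction g using Sym2.ind with
    | _ u v =>
      have hb := isAcyclic_iff_forall_adj_isBridge.1 ht.isAcyclic hg
      rw [isBridge_iff] at hb
      have hn : ¬ (u ∈ A ↔ v ∈ A) := fun h => hb ((hA u v).2 h)
      by_cases hu : u ∈ A
      · exact ⟨u, hu, v, by tauto, hg⟩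
      · exact ⟨v, by tauto, u, hu, (T.mem_edgeSet.1 hg).symm⟩
  · exact (isTree_iff_connected_and_card.1 ht).2

/-- add `ab`, delete `cd` -/
def exch (T : SimpleGraph V) (a b c d : V) : SimpleGraph V :=
  (T ⊔ SimpleGraph.fromEdgeSet {s(a, b)}).deleteEdges {s(c, d)}

theorem exch_adj {T : SimpleGraph V} {a b c d : V} {u v : V} :
    (exch T a b c d).Adj u v ↔
      (T.Adj u v ∨ (s(u, v) = s(a, b) ∧ u ≠ v)) ∧ s(u, v) ≠ s(c, d) := by
  unfold exch
  rw [deleteEdges_adj, sup_adj, fromEdgeSet_adj]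
  simp only [Set.mem_singleton_iff, ne_eq]

theorem exch_of_adj {T : SimpleGraph V} {a b c d : V} {u v : V} (h : T.Adj u v)
    (h' : s(u, v) ≠ s(c, d)) : (exch T a b c d).Adj u v := exch_adj.2 ⟨Or.inl h, h'⟩

theorem exch_new {T : SimpleGraph V} {a b c d : V} (hab : a ≠ b) (h : ¬ T.Adj a b)
    (h' : T.Adj c d) : (exch T a b c d).Adj a b := by
  refine exch_adj.2 ⟨Or.inr ⟨rfl, hab⟩, ?_⟩
  intro he
  apply h
  rw [← mem_edgeSet, he]
  exact h'

theorem exch_card [Finite V] {T : SimpleGraph V} {a b c d : V} (hab : a ≠ b) (h : ¬ T.Adj a b)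
    (h' : T.Adj c d) : (exch T a b c d).edgeSet.ncard = T.edgeSet.ncard := by
  have he : (exch T a b c d).edgeSet = (insert s(a, b) T.edgeSet) \ {s(c, d)} := by
    ext e
    induction e using Sym2.ind with
    | _ u v =>
      rw [mem_edgeSet, exch_adj]
      simp only [Set.mem_sdiff, Set.mem_insert_iff, mem_edgeSet, Set.mem_singleton_iff]
      constructor
      · rintro ⟨h1 | h1, h2⟩
        · exact ⟨Or.inr h1, h2⟩
        · exact ⟨Or.inl h1.1, h2⟩
      · rintro ⟨h1 | h1, h2⟩
        · refine ⟨Or.inr ⟨h1, ?_⟩, h2⟩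
          rintro rfl
          rw [Sym2.eq_iff] at h1
          rcases h1 with ⟨rfl, rfl⟩ | ⟨rfl, rfl⟩ <;> exact hab rfl
        · exact ⟨Or.inl h1, h2⟩
  rw [he, Set.ncard_sdiff_singleton_of_mem (Set.mem_insert_of_mem _ (T.mem_edgeSet.2 h')), Set.ncard_insert_of_notMem (by simpa using h)]
  simp

/-- one exchange inside the family `M` -/
def St (G : SimpleGraph V) (M : SimpleGraph V → Prop) (T T' : SimpleGraph V) : Prop :=
  M T ∧ M T' ∧ ∃ e ∈ G.edgeSet \ T.edgeSet, ∃ f ∈ (T ⊔ SimpleGraph.fromEdgeSet {e}).edgeSet,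
    T' = (T ⊔ SimpleGraph.fromEdgeSet {e}).deleteEdges {f}

inductive Reach {α : Type*} (R : α → α → Prop) : ℕ → α → α → Prop
  | refl (n : ℕ) (x : α) : Reach R n x x
  | cons {n : ℕ} {x y z : α} : R x y → Reach R n y z → Reach R (n + 1) x z

theorem Reach.trans {α : Type*} {R : α → α → Prop} {n m : ℕ} {x y z : α}
    (h : Reach R n x y) (h' : Reach R m y z) : Reach R (n + m) x z := by
  have mono : ∀ {k m : ℕ} {x y : α}, Reach R m x y → Reach R (m + k) x y := by
    intro k m x y h
    induction h with
    | refl n x => exact Reach.refl _ _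
    | @cons n _ _ _ h1 _ ih => rw [Nat.add_right_comm]; exact Reach.cons h1 ih
  induction h with
  | refl n x => rw [Nat.add_comm]; exact mono h'
  | cons h1 _ ih => rw [Nat.add_right_comm]; exact Reach.cons h1 (ih h')

theorem Reach.mono {α : Type*} {R : α → α → Prop} {n m : ℕ} {x y : α}
    (h : Reach R n x y) (hnm : n ≤ m) : Reach R m x y := by
  obtain ⟨k, rfl⟩ := Nat.exists_eq_add_of_le hnm
  exact h.trans (Reach.refl k y)

theorem Reach.seq {α : Type*} {R : α → α → Prop} {n : ℕ} {x y : α} (h : Reach R n x y) :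
    ∃ m ≤ n, ∃ c : ℕ → α, c 0 = x ∧ c m = y ∧ ∀ i < m, R (c i) (c (i + 1)) := by
  induction h with
  | refl n x => exact ⟨0, Nat.zero_le _, fun _ => x, rfl, rfl, by simp⟩
  | @cons n x y z h1 _ ih =>
    obtain ⟨m, hm, c, h0, h2, h3⟩ := ih
    refine ⟨m + 1, by omega, fun i => Nat.casesOn i x c, rfl, h2, ?_⟩
    intro i hi
    cases i with
    | zero => simpa [h0] using h1
    | succ j => exact h3 j (by omega)

theorem Resp.exch [Finite V] {G T : SimpleGraph V} {B B' : Set V} (h : Resp G T B)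
    {a b c d : V} (hab : G.Adj a b) (hn : ¬ T.Adj a b) (hcd : T.Adj c d)
    (h1 : Cn (exch T a b c d) B') (h2 : Cn (exch T a b c d) B'ᶜ)
    (h3 : ∃ u ∈ B', ∃ v, v ∉ B' ∧ (exch T a b c d).Adj u v) : Resp G (exch T a b c d) B' := by
  refine ⟨?_, h1, h2, h3, ?_⟩
  · intro u v huv
    rcases (exch_adj.1 huv).1 with h4 | h4
    · exact h.le h4
    · rw [← mem_edgeSet, h4.1]; exact hab
  · rw [exch_card hab.ne hn hcd]; exact h.card

theorem st_exch {G T : SimpleGraph V} {M : SimpleGraph V → Prop}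
    {a b c d : V} (hab : G.Adj a b) (hn : ¬ T.Adj a b) (hcd : T.Adj c d)
    (h1 : M T) (h2 : M (exch T a b c d)) : St G M T (exch T a b c d) := by
  refine ⟨h1, h2, s(a, b), ⟨hab, hn⟩, s(c, d), ?_, rfl⟩
  rw [mem_edgeSet]
  exact Or.inl hcd

theorem sym_ne_of {S : Set V} {u v c d : V} (hc : c ∉ S) (hu : u ∈ S) (hv : v ∈ S) :
    s(u, v) ≠ s(c, d) := by
  intro he
  rw [Sym2.eq_iff] at he
  rcases he with ⟨rfl, rfl⟩ | ⟨rfl, rfl⟩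
  · exact hc hu
  · exact hc hv

/-- Make `x` a leaf on its side. -/
theorem leafify [Finite V] {G : SimpleGraph V} {M : SimpleGraph V → Prop} {S : Set V} {x : V}
    (hM : ∀ T, Resp G T S → M T) (hx : x ∈ S) (hS : ∃ z ∈ S, z ≠ x) (hG : Cn G (S \ {x})) (n : ℕ) :
    ∀ T, Resp G T S → {u | u ∈ S ∧ T.Adj x u}.ncard ≤ n →
      ∃ T', Reach (St G M) n T T' ∧ Resp G T' S ∧ Cn T' (S \ {x}) ∧
        ∀ u v, ¬ (u ∈ S ∧ v ∈ S) → (T'.Adj u v ↔ T.Adj u v) := by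
  induction n with
  | zero =>
    intro T hT hn
    exfalso
    obtain ⟨z, hz, hzx⟩ := hS
    obtain ⟨x', hx', w, hw, rfl, hwx, hadj⟩ := hT.cB {x} ⟨x, hx, rfl⟩ ⟨z, hz, hzx⟩
    have h0 : {u | u ∈ S ∧ T.Adj x' u} = ∅ := (Set.ncard_eq_zero (Set.toFinite _)).1 (by omega)
    have : w ∈ {u | u ∈ S ∧ T.Adj x' u} := ⟨hw, hadj⟩
    rw [h0] at this
    exact this
  | succ n ih =>
    intro T hT hn
    obtain ⟨z, hz, hzx⟩ := hS
    obtain ⟨x', hx', w, hw, hxx, hwx, hadj⟩ := hT.cB {x} ⟨x, hx, rfl⟩ ⟨z, hz, hzx⟩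
    have hxx : x' = x := hxx
    subst hxx
    obtain ⟨D, hDS, hwD, hDc, hcl⟩ := exists_comp T (S \ {x'}) (p := w) ⟨hw, hwx⟩
    by_cases hD : S \ {x'} ⊆ D
    · refine ⟨T, Reach.refl _ _, hT, ?_, fun _ _ _ => Iff.rfl⟩
      rw [← hDS.antisymm hD]; exact hDc
    obtain ⟨t, htS, htD⟩ := Set.not_subset.1 hD
    obtain ⟨d, hd, d', hd', hdD, hd'D, hdd⟩ := hG D ⟨w, ⟨hw, hwx⟩, hwD⟩ ⟨t, htS, htD⟩
    have hxD : x' ∉ D := fun h => (hDS h).2 rfl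
    have hnT : ¬ T.Adj d d' := fun h => hd'D (hcl d hdD d' hd' h)
    set T' := BudAux.exch T d d' x' w with hT'
    have hold : ∀ u v, ¬ (u ∈ S ∧ v ∈ S) → (T'.Adj u v ↔ T.Adj u v) := by
      intro u v huv
      rw [hT', exch_adj]
      constructor
      · rintro ⟨h1 | ⟨h1, -⟩, h3⟩
        · exact h1
        · exfalso
          rw [Sym2.eq_iff] at h1
          rcases h1 with ⟨rfl, rfl⟩ | ⟨rfl, rfl⟩
          · exact huv ⟨hd.1, hd'.1⟩
          · exact huv ⟨hd'.1, hd.1⟩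
      · intro h
        refine ⟨Or.inl h, ?_⟩
        intro h1
        rw [Sym2.eq_iff] at h1
        rcases h1 with ⟨rfl, rfl⟩ | ⟨rfl, rfl⟩
        · exact huv ⟨hx, hw⟩
        · exact huv ⟨hw, hx⟩
    have hc1 : Cn T' D := hDc.congr fun u hu v hv huv => exch_of_adj huv (sym_ne_of hxD hu hv)
    have hc2 : Cn T (S \ D) := by
      have aux : ∀ X : Set V, x' ∉ X → (∃ u ∈ S \ D, u ∈ X) →
          ∃ u ∈ S \ D, ∃ v ∈ S \ D, u ∈ X ∧ v ∉ X ∧ T.Adj u v := by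
        rintro X hxX ⟨u, hu, huX⟩
        obtain ⟨a, ha, b, hb, haX, hbX, hab⟩ := hT.cB (X \ D) ⟨u, hu.1, huX, hu.2⟩
          ⟨x', hx, fun h => hxX h.1⟩
        have hbD : b ∉ D := by
          intro hbD
          refine haX.2 (hcl b hbD a ⟨ha, ?_⟩ hab.symm)
          rintro rfl
          exact hxX haX.1
        exact ⟨a, ⟨ha, haX.2⟩, b, ⟨hb, hbD⟩, haX.1, fun h => hbX ⟨h, hbD⟩, hab⟩
      intro X h1 h2
      by_cases hxX : x' ∈ X
      · obtain ⟨u, hu, v, hv, h4, h5, h6⟩ := aux Xᶜ (fun h => h hxX) h2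
        exact ⟨v, hv, u, hu, not_not.1 h5, h4, h6.symm⟩
      · exact aux X hxX h1
    have hc3 : Cn T' (S \ D) := hc2.congr fun u hu v hv huv => exch_of_adj huv (by
      rw [Sym2.eq_swap (a := x')]
      exact sym_ne_of (S := S \ D) (fun h => h.2 hwD) hu hv)
    have hc4 : Cn T' S := by
      have := hc1.union hc3 hdD ⟨hd'.1, hd'D⟩ (exch_new hdd.ne hnT hadj)
      rwa [Set.union_sdiff_cancel (fun t ht => (hDS ht).1)] at this
    have hR : Resp G T' S := by
      refine hT.exch hdd hnT hadj hc4 (hT.cA.congr fun u hu v hv huv =>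
        (hold u v fun h => hu h.1).2 huv) ?_
      obtain ⟨u, hu, v, hv, huv⟩ := hT.cross
      exact ⟨u, hu, v, hv, (hold u v fun h => hv h.2).2 huv⟩
    have hlt : {u | u ∈ S ∧ T'.Adj x' u}.ncard ≤ n := by
      have : {u | u ∈ S ∧ T'.Adj x' u}.ncard < {u | u ∈ S ∧ T.Adj x' u}.ncard := by
        refine Set.ncard_lt_ncard ?_ (Set.toFinite _)
        refine ⟨?_, fun h => ?_⟩
        · rintro u ⟨hu, hu'⟩
          refine ⟨hu, ?_⟩
          rcases (exch_adj.1 hu').1 with h | ⟨h, -⟩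
          · exact h
          · exfalso
            rw [Sym2.eq_iff] at h
            rcases h with ⟨rfl, -⟩ | ⟨rfl, -⟩
            · exact hxD hdD
            · exact hd'.2 rfl
        · have h1 := h (a := w) ⟨hw, hadj⟩
          exact (exch_adj.1 h1.2).2 rfl
      omega
    obtain ⟨T'', h1, h2, h3, h4⟩ := ih T' hR hlt
    refine ⟨T'', Reach.cons (st_exch hdd hnT hadj (hM _ hT) (hM _ hR)) h1, h2, h3, ?_⟩
    intro u v huv
    rw [h4 u v huv, hold u v huv]

/-- Move the crossing edge. -/
theorem moveCross [Finite V] {G T : SimpleGraph V} {M : SimpleGraph V → Prop} {B : Set V}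
    (hM : ∀ T, Resp G T B → M T) (hT : Resp G T B) {z x : V} (hz : z ∈ B) (hx : x ∉ B)
    (hzx : G.Adj z x) : ∃ T', Reach (St G M) 1 T T' ∧ Resp G T' B ∧ T'.Adj z x ∧
      (∀ u v, (u ∈ B ↔ v ∈ B) → T.Adj u v → T'.Adj u v) := by
  by_cases h : T.Adj z x
  · exact ⟨T, Reach.refl _ _, hT, h, fun _ _ _ h => h⟩
  obtain ⟨u, hu, v, hv, huv⟩ := hT.cross
  have hold : ∀ a b, (a ∈ B ↔ b ∈ B) → T.Adj a b → (BudAux.exch T z x u v).Adj a b := by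
    intro a b hab hadj
    refine exch_of_adj hadj ?_
    intro he
    rw [Sym2.eq_iff] at he
    rcases he with ⟨rfl, rfl⟩ | ⟨rfl, rfl⟩ <;> tauto
  have hnew := exch_new hzx.ne h huv
  have hR : Resp G (BudAux.exch T z x u v) B := by
    refine hT.exch hzx h huv (hT.cB.congr ?_) (hT.cA.congr ?_) ⟨z, hz, x, hx, hnew⟩
    · exact fun a ha b hb => hold a b (by tauto)
    · exact fun a ha b hb => hold a b (by simp only [Set.mem_compl_iff] at ha hb; tauto)
  exact ⟨_, Reach.cons (st_exch hzx h huv (hM _ hT) (hM _ hR)) (Reach.refl 0 _), hR, hnew, hold⟩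

theorem swap [Finite V] {G T : SimpleGraph V} {M : SimpleGraph V → Prop} {B : Set V} {k : ℕ}
    (hdeg : ∀ v, {u | G.Adj v u}.ncard ≤ 4)
    (h2 : ∀ v, Cn G {v}ᶜ) (hM : ∀ B : Set V, B.ncard = k → ∀ T, Resp G T B → M T)
    (hk : B.ncard = k) (hT : Resp G T B) {p x : V} (hp : p ∈ B) (hx : x ∉ B) (hpx : G.Adj p x)
    (hxp : ∀ u ∈ B, G.Adj u x → u = p) (hA : ∃ c, c ∉ B ∧ c ≠ x) (hG : Cn G (Bᶜ \ {x})) :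
    ∃ T' B', Reach (St G M) 10 T T' ∧ Resp G T' B' ∧ B'.ncard = k ∧ x ∈ B' ∧ B' ⊆ insert x B := by
  have hMA : ∀ T, Resp G T Bᶜ → M T := fun T h => hM B hk T (by simpa using h.compl)
  have hdeg' : ∀ (T : SimpleGraph V) (S : Set V) (v : V), T ≤ G → {u | u ∈ S ∧ T.Adj v u}.ncard ≤ 4 := by
    intro T S v hle
    exact (Set.ncard_le_ncard (fun u hu => hle hu.2) (Set.toFinite _)).trans (hdeg v)
  obtain ⟨c, hcB, hcx⟩ := hA
  obtain ⟨T1, r1, R1, C1, E1⟩ := leafify hMA (x := x) hx ⟨c, hcB, hcx⟩ hG 4 T hT.compl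
    (hdeg' T _ x hT.le)
  have R1' : Resp G T1 B := by simpa using R1.compl
  by_cases hne : ∃ q ∈ B, q ≠ p
  · obtain ⟨y, hyB, hyp, hCy, d, hdB, hyd⟩ := exists_release h2
      (hT.cB.congr fun u _ v _ h => hT.le h) hp hne ⟨c, hcB⟩
    have hdx : d ≠ x := by rintro rfl; exact hyp (hxp y hyB hyd)
    obtain ⟨T2, r2, R2, C2, E2⟩ := leafify (hM B hk) (x := y) hyB ⟨p, hp, hyp.symm⟩ hCy 4 T1 R1'
      (hdeg' T1 _ y R1'.le)
    have C1' : Cn T2 (Bᶜ \ {x}) := C1.congr fun u hu v hv h =>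
      (E2 u v fun h => hu.1 h.1).2 h
    obtain ⟨T3, r3, R3, hpx3, E3⟩ := moveCross (hM B hk) R2 hp hx hpx
    have CA : Cn T3 (Bᶜ \ {x}) := C1'.congr fun u hu v hv h =>
      E3 u v (by have := hu.1; have := hv.1; simp only [Set.mem_compl_iff] at *; tauto) h
    have CB : Cn T3 (B \ {y}) := C2.congr fun u hu v hv h =>
      E3 u v (by have := hu.1; have := hv.1; tauto) h
    obtain ⟨y1, hy1, y', hy'B, hyy, hy'y, hyy'⟩ := R3.cB {y} ⟨y, hyB, rfl⟩ ⟨p, hp, hyp.symm⟩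
    have hyy : y1 = y := hyy
    subst hyy
    obtain ⟨x1, hx1, x', hx'B, hxx, hx'x, hxx'⟩ := R3.cA {x} ⟨x, hx, rfl⟩ ⟨c, hcB, hcx⟩
    have hxx : x1 = x := hxx
    subst hxx
    have hnT : ¬ T3.Adj y1 d := fun h => hyp (R3.cross_unique hyB hdB h hp hx hpx3).1
    set T4 := BudAux.exch T3 y1 d y1 y' with hT4
    have hxy : x1 ≠ y1 := by rintro rfl; exact hx hyB
    have CA4 : Cn T4 (insert y1 (Bᶜ \ {x1})) := by
      refine Cn.insert' (s := d) (CA.congr fun u hu v hv h => exch_of_adj h ?_) ⟨hdB, hdx⟩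
        (exch_new hyd.ne hnT hyy').symm
      exact sym_ne_of (S := Bᶜ) (fun h => h hyB) hu.1 hv.1
    have CB4 : Cn T4 (insert x1 (B \ {y1})) := by
      refine Cn.insert' (s := p) (CB.congr fun u hu v hv h => exch_of_adj h ?_) ⟨hp, hyp.symm⟩ ?_
      · exact sym_ne_of (S := B \ {y1}) (fun h => h.2 rfl) hu hv
      · refine exch_of_adj hpx3 ?_
        exact sym_ne_of (S := {y1}ᶜ) (fun h => h rfl) hyp.symm hxy
    have hcompl : (insert x1 (B \ {y1}))ᶜ = insert y1 (Bᶜ \ {x1}) := by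
      ext t
      simp only [Set.mem_compl_iff, Set.mem_insert_iff, Set.mem_sdiff, Set.mem_singleton_iff]
      by_cases h1 : t = y1
      · subst h1; simp [hyB, hxy.symm]
      · by_cases h3 : t = x1
        · subst h3; simp [h1]
        · simp [h1, h3]
    have hcard : (insert x1 (B \ {y1})).ncard = k := by
      rw [Set.ncard_insert_of_notMem (fun h => hx h.1), Set.ncard_sdiff_singleton_add_one hyB, hk]
    have hR4 : Resp G T4 (insert x1 (B \ {y1})) := by
      refine R3.exch hyd hnT hyy' CB4 (by rw [hcompl]; exact CA4) ⟨x1, Or.inl rfl, x', ?_, ?_⟩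
      · rintro (h | h)
        · exact hx'x h
        · exact hx'B h.1
      · exact exch_of_adj hxx' (sym_ne_of (S := Bᶜ) (fun h => h hyB) hx hx'B)
    refine ⟨T4, _, ?_, hR4, hcard, Or.inl rfl, Set.insert_subset_insert Set.sdiff_subset⟩
    have r4 : Reach (St G M) 1 T3 T4 :=
      Reach.cons (st_exch hyd hnT hyy' (hM _ hk _ R3) (hM _ hcard _ hR4)) (Reach.refl 0 _)
    exact ((r1.trans r2).trans r3).trans r4
  · have hBp : B = {p} := by
      ext q
      constructor
      · intro hq
        by_contra h
        exact hne ⟨q, hq, h⟩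
      · rintro rfl; exact hp
    subst hBp
    have hcp : c ≠ p := hcB
    obtain ⟨p', hp', d, hdx, hpp, hdp, hpd⟩ := h2 x {p} ⟨p, fun h => hx h.symm, rfl⟩ ⟨c, hcx, hcB⟩
    have hpp : p' = p := hpp
    subst hpp
    obtain ⟨T3, r3, R3, hpx3, E3⟩ := moveCross (hM _ hk) R1' hp hdp hpd
    have CA : Cn T3 ({p'}ᶜ \ {x}) := C1.congr fun u hu v hv h =>
      E3 u v (by have := hu.1; have := hv.1; simp only [Set.mem_compl_iff] at *; tauto) h
    obtain ⟨x1, hx1, x', hx'B, hxx, hx'x, hxx'⟩ := R3.cA {x} ⟨x, hx, rfl⟩ ⟨c, hcB, hcx⟩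
    have hxx : x1 = x := hxx
    subst hxx
    refine ⟨T3, {x1}, (r1.trans r3).mono (by norm_num), ?_, ?_, rfl, by simp⟩
    · refine ⟨R3.le, Cn.singleton _ _, ?_, ⟨x1, rfl, x', hx'x, hxx'⟩, R3.card⟩
      have := CA.insert' (s := d) ⟨hdp, hdx⟩ hpx3.symm
      convert this using 1
      ext t
      simp only [Set.mem_compl_iff, Set.mem_insert_iff, Set.mem_sdiff, Set.mem_singleton_iff]
      by_cases h1 : t = p'
      · subst h1; simpa using fun h => hx h.symm
      · simp [h1]
    · rw [← hk]; simp
end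

section geom

theorem lat_four {u w : ℤ × ℤ} (h : latticeGraph.Adj u w) :
    w = (u.1 + 1, u.2) ∨ w = (u.1 - 1, u.2) ∨ w = (u.1, u.2 + 1) ∨ w = (u.1, u.2 - 1) := by
  obtain ⟨x, y⟩ := u
  obtain ⟨x', y'⟩ := w
  rw [latticeGraph, fromRel_adj] at h
  have h1 : (x - x') ^ 2 + (y - y') ^ 2 = 1 := by
    rcases h.2 with h | h
    · exact h
    · simp only at h; nlinarith
  simp only [Prod.mk.injEq]
  have a1 : x - x' ≤ 1 := by nlinarith [sq_nonneg (y - y')]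
  have a2 : -1 ≤ x - x' := by nlinarith [sq_nonneg (y - y')]
  have b1 : y - y' ≤ 1 := by nlinarith [sq_nonneg (x - x')]
  have b2 : -1 ≤ y - y' := by nlinarith [sq_nonneg (x - x')]
  generalize hs : x - x' = s at *
  generalize ht : y - y' = t at *
  have hs' : s = -1 ∨ s = 0 ∨ s = 1 := by omega
  have ht' : t = -1 ∨ t = 0 ∨ t = 1 := by omega
  rcases hs' with rfl | rfl | rfl <;> rcases ht' with rfl | rfl | rfl <;> simp at h1 <;> omega

theorem lat_up (x y : ℤ) : latticeGraph.Adj (x, y) (x, y + 1) := by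
  rw [latticeGraph, fromRel_adj]
  refine ⟨by simp, Or.inl ?_⟩
  simp

variable (Γ : SimpleGridGraph)

theorem mem_bd_of_edge {u v : ℤ × ℤ} (h : s(u, v) ∈ Γ.loopEdges) :
    u ∈ Γ.boundary ∧ v ∈ Γ.boundary :=
  ⟨Γ.loop.fst_mem_support_of_mem_edges h, Γ.loop.snd_mem_support_of_mem_edges h⟩

theorem exists_bound : ∃ N : ℤ, ∀ v ∈ Γ.boundary, -N < v.1 ∧ v.1 < N ∧ -N < v.2 ∧ v.2 < N := by
  have h : ∀ l : List (ℤ × ℤ), ∃ N : ℤ, ∀ v ∈ l, -N < v.1 ∧ v.1 < N ∧ -N < v.2 ∧ v.2 < N := by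
    intro l
    induction l with
    | nil => exact ⟨0, by simp⟩
    | cons a l ih =>
      obtain ⟨N, hN⟩ := ih
      refine ⟨max N (|a.1| + |a.2| + 1), ?_⟩
      intro v hv
      rcases List.mem_cons.1 hv with rfl | hv
      · have := abs_nonneg v.1; have := abs_nonneg v.2
        have := le_abs_self v.1; have := neg_abs_le v.1
        have := le_abs_self v.2; have := neg_abs_le v.2
        omega
      · have := hN v hv; omega
  exact h Γ.loop.support

open Classical in
theorem deg_even (x y : ℤ) :
    Even ((if s(((x + 1, y) : ℤ × ℤ), (x + 1, y + 1)) ∈ Γ.loopEdges then 1 else 0)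
      + (if s(((x + 1, y + 1) : ℤ × ℤ), (x + 1, y + 1 + 1)) ∈ Γ.loopEdges then 1 else 0)
      + (if s(((x, y + 1) : ℤ × ℤ), (x + 1, y + 1)) ∈ Γ.loopEdges then 1 else 0)
      + (if s(((x + 1, y + 1) : ℤ × ℤ), (x + 1 + 1, y + 1)) ∈ Γ.loopEdges then 1 else 0) : ℕ) := by
  have h1 := (Γ.isCycle.isTrail.even_countP_edges_iff (x + 1, y + 1)).2 (fun h => absurd rfl h)
  have h2 : Γ.loop.edges.countP (fun e => (x + 1, y + 1) ∈ e) =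
      (({s((x + 1, y), (x + 1, y + 1)), s((x + 1, y + 1), (x + 1, y + 1 + 1)),
        s((x, y + 1), (x + 1, y + 1)), s((x + 1, y + 1), (x + 1 + 1, y + 1))} :
        Finset (Sym2 (ℤ × ℤ))).filter (fun e => e ∈ Γ.loopEdges)).card := by
    rw [List.countP_eq_length_filter, ← List.toFinset_card_of_nodup
      (Γ.isCycle.isTrail.edges_nodup.filter _)]
    congr 1
    ext e
    simp only [List.mem_toFinset, List.mem_filter, decide_eq_true_eq, Finset.mem_filter,
      Finset.mem_insert, Finset.mem_singleton]
    constructor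
    · rintro ⟨he, hm⟩
      refine ⟨?_, he⟩
      obtain ⟨w, rfl⟩ := hm
      have ha := lat_four (Γ.loop.adj_of_mem_edges he)
      simp only [add_sub_cancel_right] at ha
      rcases ha with rfl | rfl | rfl | rfl
      · simp
      · right; right; left; exact Sym2.eq_swap
      · simp
      · left; exact Sym2.eq_swap
    · rintro ⟨h, he⟩
      refine ⟨he, ?_⟩
      rcases h with rfl | rfl | rfl | rfl <;> simp
  have h3 : Even (Γ.loop.edges.countP (fun e => (x + 1, y + 1) ∈ e)) := by
    convert h1
  rw [h2, Finset.card_filter, Finset.sum_insert, Finset.sum_insert, Finset.sum_insert,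
    Finset.sum_singleton] at h3
  · simpa only [add_assoc] using h3
  all_goals simp <;> omega

/-- number of vertical loop edges to the right -/
noncomputable def cnt (x y : ℤ) : ℕ :=
  Set.ncard {t : ℤ | x < t ∧ s(((t, y) : ℤ × ℤ), (t, y + 1)) ∈ Γ.loopEdges}

theorem vInterior_iff (x y : ℤ) : vInterior Γ.loopEdges (x, y) ↔ Odd (cnt Γ x y) := Iff.rfl

theorem cnt_fin (x y : ℤ) :
    {t : ℤ | x < t ∧ s(((t, y) : ℤ × ℤ), (t, y + 1)) ∈ Γ.loopEdges}.Finite := by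
  obtain ⟨N, hN⟩ := exists_bound Γ
  refine (Set.finite_Icc x N).subset ?_
  rintro t ⟨h1, h2⟩
  have := (hN _ (mem_bd_of_edge Γ h2).1).2.1
  exact ⟨h1.le, this.le⟩

open Classical in
theorem cnt_step (x y : ℤ) : cnt Γ x y = cnt Γ (x + 1) y +
    (if s(((x + 1, y) : ℤ × ℤ), (x + 1, y + 1)) ∈ Γ.loopEdges then 1 else 0) := by
  unfold cnt
  split_ifs with h
  · rw [← Set.ncard_insert_of_notMem (a := x + 1) (by simp) (cnt_fin Γ _ _)]
    congr 1
    ext t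
    simp only [Set.mem_ofPred_eq, Set.mem_insert_iff]
    constructor
    · rintro ⟨h1, h2⟩
      by_cases ht : t = x + 1
      · exact Or.inl ht
      · exact Or.inr ⟨by omega, h2⟩
    · rintro (rfl | ⟨h1, h2⟩)
      · exact ⟨by omega, h⟩
      · exact ⟨by omega, h2⟩
  · rw [add_zero]
    congr 1
    ext t
    simp only [Set.mem_ofPred_eq]
    constructor
    · rintro ⟨h1, h2⟩
      refine ⟨?_, h2⟩
      by_contra hn
      have : t = x + 1 := by omega
      subst this
      exact h h2
    · rintro ⟨h1, h2⟩
      exact ⟨by omega, h2⟩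

open Classical in
theorem cnt_parity (x y : ℤ) : Even (cnt Γ x y + cnt Γ x (y + 1) +
    (if s(((x, y + 1) : ℤ × ℤ), (x + 1, y + 1)) ∈ Γ.loopEdges then 1 else 0)) := by
  obtain ⟨N, hN⟩ := exists_bound Γ
  have key : ∀ k : ℕ, ∀ x : ℤ, N - x ≤ k → Even (cnt Γ x y + cnt Γ x (y + 1) +
    (if s(((x, y + 1) : ℤ × ℤ), (x + 1, y + 1)) ∈ Γ.loopEdges then 1 else 0)) := by
    intro k
    induction k with
    | zero =>
      intro x hx
      have hz : ∀ y, cnt Γ x y = 0 := by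
        intro y
        unfold cnt
        rw [Set.ncard_eq_zero (cnt_fin Γ x y), Set.eq_empty_iff_forall_notMem]
        rintro t ⟨h1, h2⟩
        have := (hN _ (mem_bd_of_edge Γ h2).1).2.1
        simp only at this
        push_cast at hx
        omega
      rw [hz, hz, if_neg]
      · simp
      · intro h
        have := (hN _ (mem_bd_of_edge Γ h).1).2.1
        simp only at this
        push_cast at hx
        omega
    | succ k ih =>
      intro x hx
      have h1 := ih (x + 1) (by push_cast at hx; omega)
      have h2 := deg_even Γ x y
      rw [cnt_step Γ x y, cnt_step Γ x (y + 1)]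
      rw [Nat.even_iff] at *
      omega
  exact key (N - x).toNat x (by omega)

theorem vstep {x y : ℤ} (h : (x, y + 1) ∉ Γ.boundary) :
    vInterior Γ.loopEdges (x, y) ↔ vInterior Γ.loopEdges (x, y + 1) := by
  classical
  have h1 := cnt_parity Γ x y
  rw [if_neg (fun h' => h (mem_bd_of_edge Γ h').1), add_zero, Nat.even_add] at h1
  rw [vInterior_iff, vInterior_iff, ← Nat.not_even_iff_odd, ← Nat.not_even_iff_odd, h1]

theorem verts_bound : ∃ N : ℤ, ∀ v ∈ Γ.verts, -N ≤ v.1 ∧ v.1 ≤ N ∧ -N ≤ v.2 ∧ v.2 ≤ N := by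
  obtain ⟨N, hN⟩ := exists_bound Γ
  refine ⟨N, ?_⟩
  have hpos : ∀ x y, vInterior Γ.loopEdges (x, y) → x < N ∧ -N < y ∧ y < N := by
    intro x y h
    rw [vInterior_iff] at h
    have h0 : cnt Γ x y ≠ 0 := by rintro h0; rw [h0] at h; exact absurd h (by decide)
    obtain ⟨t, h1, h2⟩ := Set.nonempty_of_ncard_ne_zero h0
    have := hN _ (mem_bd_of_edge Γ h2).1
    simp only at this
    omega
  rintro ⟨x, y⟩ (h | h)
  · have := hN _ h
    exact ⟨this.1.le, this.2.1.le, this.2.2.1.le, this.2.2.2.le⟩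
  · obtain ⟨h1, h2, h3⟩ := hpos x y h
    refine ⟨?_, h1.le, h2.le, h3.le⟩
    by_contra hx
    simp only [not_le] at hx
    have : ∀ k : ℕ, vInterior Γ.loopEdges (x, y + k) := by
      intro k
      induction k with
      | zero => simpa using h
      | succ k ih =>
        have := (vstep Γ (x := x) (y := y + k) (fun hb => by
          have := (hN _ hb).1; simp only at this; omega)).1 ih
        push_cast
        rwa [← add_assoc]
    have := (hpos _ _ (this (N - y).toNat)).2.2
    omega

theorem verts_finite : Finite ↥Γ.verts := by
  obtain ⟨N, hN⟩ := verts_bound Γ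
  refine Set.Finite.to_subtype (((Set.finite_Icc (-N) N).prod (Set.finite_Icc (-N) N)).subset ?_)
  intro v hv
  obtain ⟨a, b, c, d⟩ := hN v hv
  exact ⟨⟨a, b⟩, ⟨c, d⟩⟩

theorem adj_lat {u v : ↥Γ.verts} (h : Γ.graph.Adj u v) : latticeGraph.Adj u.1 v.1 := by
  rw [SimpleGridGraph.graph, fromRel_adj] at h
  rcases h.2 with h | h
  · exact h.1
  · exact h.1.symm

theorem adj_of {u v : ↥Γ.verts} (h : latticeGraph.Adj u.1 v.1) (h' : edgeOK Γ.loopEdges u.1 v.1) :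
    Γ.graph.Adj u v := by
  rw [SimpleGridGraph.graph, fromRel_adj]
  exact ⟨fun he => h.ne (congrArg Subtype.val he), Or.inl ⟨h, h'⟩⟩

theorem exists_up {u : ↥Γ.verts} (hu : u.1 ∉ Γ.boundary) :
    ∃ w : ↥Γ.verts, w.1 = (u.1.1, u.1.2 + 1) ∧ Γ.graph.Adj u w := by
  obtain ⟨⟨x, y⟩, h⟩ := u
  have hv : vInterior Γ.loopEdges (x, y) := h.resolve_left hu
  have hw : (x, y + 1) ∈ Γ.verts := by
    by_cases hb : (x, y + 1) ∈ Γ.boundary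
    · exact Or.inl hb
    · exact Or.inr ((vstep Γ hb).1 hv)
  refine ⟨⟨_, hw⟩, rfl, adj_of Γ (lat_up x y) (Or.inr (Or.inl ⟨rfl, ?_⟩))⟩
  simpa using hv

theorem exists_down {u : ↥Γ.verts} (hu : u.1 ∉ Γ.boundary) :
    ∃ w : ↥Γ.verts, w.1 = (u.1.1, u.1.2 - 1) ∧ Γ.graph.Adj u w := by
  obtain ⟨⟨x, y'⟩, h⟩ := u
  obtain ⟨y, rfl⟩ : ∃ y, y' = y + 1 := ⟨y' - 1, by ring⟩
  have hv : vInterior Γ.loopEdges (x, y + 1) := h.resolve_left hu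
  have hv' := (vstep Γ hu).2 hv
  have hw : (x, y) ∈ Γ.verts := Or.inr hv'
  refine ⟨⟨_, hw⟩, by simp, (adj_of Γ (u := ⟨(x, y), hw⟩) (v := ⟨(x, y + 1), h⟩)
    (lat_up x y) (Or.inr (Or.inl ⟨rfl, ?_⟩))).symm⟩
  simpa using hv'

theorem deg_le (v : ↥Γ.verts) : {u | Γ.graph.Adj v u}.ncard ≤ 4 := by
  classical
  rw [← Set.ncard_image_of_injective _ Subtype.val_injective]
  have hsub : Subtype.val '' {u | Γ.graph.Adj v u} ⊆
      (({(v.1.1 + 1, v.1.2), (v.1.1 - 1, v.1.2), (v.1.1, v.1.2 + 1), (v.1.1, v.1.2 - 1)} :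
        Finset (ℤ × ℤ)) : Set (ℤ × ℤ)) := by
    rintro _ ⟨u, hu, rfl⟩
    have := lat_four (adj_lat Γ hu)
    simpa using this
  refine (Set.ncard_le_ncard hsub (Finset.finite_toSet _)).trans ?_
  rw [Set.ncard_coe_finset]
  exact Finset.card_le_four

theorem loop_walk (v : ℤ × ℤ) : ∃ w0, ∀ u ∈ Γ.boundary, u ≠ v →
    ∃ q : latticeGraph.Walk w0 u, (∀ e ∈ q.edges, e ∈ Γ.loop.edges) ∧ v ∉ q.support := by
  classical
  by_cases hv : v ∈ Γ.loop.support
  · have hc := Γ.isCycle.rotate hv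
    have hmem : ∀ u, u ∈ (Γ.loop.rotate v hv).support ↔ u ∈ Γ.loop.support :=
      fun u => Walk.mem_support_rotate_iff _ _ _
    have hed : ∀ e, e ∈ (Γ.loop.rotate v hv).edges ↔ e ∈ Γ.loop.edges :=
      fun e => (Γ.loop.rotate_edges v hv).mem_iff
    generalize Γ.loop.rotate v hv = c at hc hmem hed
    cases c with
    | nil => exact absurd hc (by simp)
    | @cons _ w0 _ h p =>
      have hp : p.IsPath := (Walk.cons_isCycle_iff p h).1 hc |>.1
      refine ⟨w0, fun u hu huv => ?_⟩
      have hup : u ∈ p.support := by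
        have := (hmem u).2 hu
        rw [Walk.support_cons, List.mem_cons] at this
        exact this.resolve_left huv
      refine ⟨p.takeUntil u hup, ?_, Walk.endpoint_notMem_support_takeUntil hp hup huv.symm⟩
      intro e he
      exact (hed e).1 (List.mem_cons_of_mem _ (p.edges_takeUntil_subset_edges hup he))
  · refine ⟨Γ.base, fun u hu huv => ⟨Γ.loop.takeUntil u hu, ?_, ?_⟩⟩
    · exact fun e he => Γ.loop.edges_takeUntil_subset_edges hu he
    · exact fun h => hv (Γ.loop.support_takeUntil_subset_support hu h)

theorem loop_cn (v : ↥Γ.verts) : Cn Γ.graph ({w | w.1 ∈ Γ.boundary} \ {v}) := by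
  rintro X ⟨u, ⟨hu, huv⟩, huX⟩ ⟨w, ⟨hw, hwv⟩, hwX⟩
  obtain ⟨w0, h0⟩ := loop_walk Γ v.1
  obtain ⟨q1, hq1, hv1⟩ := h0 u.1 hu (fun h => huv (Subtype.ext h))
  obtain ⟨q2, hq2, hv2⟩ := h0 w.1 hw (fun h => hwv (Subtype.ext h))
  obtain ⟨d, hd, h1, h2⟩ := (q1.reverse.append q2).exists_boundary_dart
    {z | ∃ h : z ∈ Γ.verts, (⟨z, h⟩ : ↥Γ.verts) ∈ X} ⟨u.2, huX⟩ (fun ⟨_, h⟩ => hwX h)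
  have he : s(d.fst, d.snd) ∈ Γ.loopEdges := by
    have : d.edge ∈ (q1.reverse.append q2).edges := List.mem_map_of_mem hd
    rw [Walk.edges_append, List.mem_append, Walk.edges_reverse, List.mem_reverse] at this
    rcases this with h | h
    · exact hq1 _ h
    · exact hq2 _ h
  have hs : ∀ z ∈ (q1.reverse.append q2).support, z ≠ v.1 := by
    rintro z hz rfl
    rw [Walk.mem_support_append_iff, Walk.support_reverse, List.mem_reverse] at hz
    rcases hz with h | h
    · exact hv1 h
    · exact hv2 h
  have hb := mem_bd_of_edge Γ he
  obtain ⟨h3, h4⟩ := h1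
  refine ⟨⟨d.fst, h3⟩, ⟨hb.1, fun h => hs _ (Walk.dart_fst_mem_support_of_mem_darts _ hd)
    (congrArg Subtype.val h)⟩, ⟨d.snd, Or.inl hb.2⟩, ⟨hb.2, fun h => hs _
    (Walk.dart_snd_mem_support_of_mem_darts _ hd) (congrArg Subtype.val h)⟩, h4,
    fun h => h2 ⟨_, h⟩, adj_of Γ d.adj (Or.inl he)⟩

theorem exists_bd_ne (v : ↥Γ.verts) : ∃ w : ↥Γ.verts, w.1 ∈ Γ.boundary ∧ w ≠ v := by
  have hsn := Γ.loop.adj_snd Γ.isCycle.not_nil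
  by_cases h : v.1 = Γ.base
  · have hb : Γ.loop.snd ∈ Γ.boundary := Γ.loop.getVert_mem_support 1
    refine ⟨⟨_, Or.inl hb⟩, hb, ?_⟩
    rintro rfl
    exact hsn.ne h.symm
  · have hb : Γ.base ∈ Γ.boundary := Γ.loop.start_mem_support
    refine ⟨⟨_, Or.inl hb⟩, hb, ?_⟩
    rintro rfl
    exact h rfl

variable {Γ}

theorem col_up {Q S : Set ↥Γ.verts} (hcl : ∀ u ∈ Q, ∀ v ∈ S, Γ.graph.Adj u v → v ∈ Q)
    (hb : ∀ w ∈ S, w.1 ∈ Γ.boundary → w ∈ Q) (u : ↥Γ.verts)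
    (h : ∀ w : ↥Γ.verts, w.1.1 = u.1.1 → u.1.2 ≤ w.1.2 → w ∈ S) : u ∈ Q := by
  obtain ⟨N, hN⟩ := verts_bound Γ
  have key : ∀ k : ℕ, ∀ u : ↥Γ.verts, N - u.1.2 < k →
      (∀ w : ↥Γ.verts, w.1.1 = u.1.1 → u.1.2 ≤ w.1.2 → w ∈ S) → u ∈ Q := by
    intro k
    induction k with
    | zero =>
      intro u hu
      have := hN u.1 u.2
      push_cast at hu
      omega
    | succ k ih =>
      intro u hu hS
      by_cases hub : u.1 ∈ Γ.boundary
      · exact hb u (hS u rfl le_rfl) hub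
      obtain ⟨w, hw, ha⟩ := exists_up Γ hub
      have hw1 : w.1.1 = u.1.1 := by rw [hw]
      have hw2 : w.1.2 = u.1.2 + 1 := by rw [hw]
      refine hcl w (ih w (by push_cast at hu; omega) ?_) u (hS u rfl le_rfl) ha.symm
      exact fun z h1 h2 => hS z (by omega) (by omega)
  exact key (N - u.1.2 + 1).toNat u (by omega) h

theorem col_down {Q S : Set ↥Γ.verts} (hcl : ∀ u ∈ Q, ∀ v ∈ S, Γ.graph.Adj u v → v ∈ Q)
    (hb : ∀ w ∈ S, w.1 ∈ Γ.boundary → w ∈ Q) (u : ↥Γ.verts)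
    (h : ∀ w : ↥Γ.verts, w.1.1 = u.1.1 → w.1.2 ≤ u.1.2 → w ∈ S) : u ∈ Q := by
  obtain ⟨N, hN⟩ := verts_bound Γ
  have key : ∀ k : ℕ, ∀ u : ↥Γ.verts, N + u.1.2 < k →
      (∀ w : ↥Γ.verts, w.1.1 = u.1.1 → w.1.2 ≤ u.1.2 → w ∈ S) → u ∈ Q := by
    intro k
    induction k with
    | zero =>
      intro u hu
      have := hN u.1 u.2
      push_cast at hu
      omega
    | succ k ih =>
      intro u hu hS
      by_cases hub : u.1 ∈ Γ.boundary
      · exact hb u (hS u rfl le_rfl) hub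
      obtain ⟨w, hw, ha⟩ := exists_down Γ hub
      have hw1 : w.1.1 = u.1.1 := by rw [hw]
      have hw2 : w.1.2 = u.1.2 - 1 := by rw [hw]
      refine hcl w (ih w (by push_cast at hu; omega) ?_) u (hS u rfl le_rfl) ha.symm
      exact fun z h1 h2 => hS z (by omega) (by omega)
  exact key (N + u.1.2 + 1).toNat u (by omega) h

theorem two_conn (v : ↥Γ.verts) : Cn Γ.graph {v}ᶜ := by
  have := verts_finite Γ
  obtain ⟨l, hl, hlv⟩ := exists_bd_ne Γ v
  obtain ⟨Q, hQ, hlQ, hc, hcl⟩ := exists_comp Γ.graph {v}ᶜ (p := l) hlv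
  have hsub := (loop_cn Γ v).subset_of_closed (fun t ht => ht.2) hcl (p := l) ⟨hl, hlv⟩ hlQ
  have hb : ∀ w ∈ ({v}ᶜ : Set ↥Γ.verts), w.1 ∈ Γ.boundary → w ∈ Q := fun w h1 h2 => hsub ⟨h2, h1⟩
  have : {v}ᶜ ⊆ Q := by
    intro u hu
    have hu : u ≠ v := hu
    by_cases h : v.1.1 = u.1.1 ∧ u.1.2 ≤ v.1.2
    · refine col_down hcl hb u fun w h1 h2 hw => hu ?_
      have hw : w = v := hw
      subst hw
      exact Subtype.ext (Prod.ext h.1.symm (le_antisymm h.2 h2))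
    · refine col_up hcl hb u fun w h1 h2 hw => h ?_
      have hw : w = v := hw
      subst hw
      exact ⟨h1, h2⟩
  rw [← hQ.antisymm this]
  exact hc

theorem top_conn {B : Set ↥Γ.verts} (hA : Cn Γ.graph Bᶜ) {p x : ↥Γ.verts} (hp : p ∈ B)
    (hx : x.1 = (p.1.1, p.1.2 + 1)) (hxB : x ∉ B) (htop : ∀ q ∈ B, q.1.2 ≤ p.1.2)
    (hbd : ∀ q ∈ B, q.1 ∉ Γ.boundary) : Cn Γ.graph (Bᶜ \ {x}) := by
  have := verts_finite Γ
  have hx1 : x.1.1 = p.1.1 := by rw [hx]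
  have hx2 : x.1.2 = p.1.2 + 1 := by rw [hx]
  obtain ⟨l, hl, hlv⟩ := exists_bd_ne Γ x
  obtain ⟨Q, hQ, hlQ, hc, hcl⟩ := exists_comp Γ.graph (Bᶜ \ {x}) (p := l)
    ⟨fun h => hbd l h hl, hlv⟩
  have hsub := (loop_cn Γ x).subset_of_closed (S := Bᶜ \ {x})
    (fun t ht => ⟨fun h => hbd t h ht.1, ht.2⟩) hcl (p := l) ⟨hl, hlv⟩ hlQ
  have hb : ∀ w ∈ Bᶜ \ {x}, w.1 ∈ Γ.boundary → w ∈ Q := fun w h1 h2 => hsub ⟨h2, h1.2⟩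
  have : Bᶜ \ {x} ⊆ Q := by
    by_contra hn
    obtain ⟨s, hs, hsQ⟩ := Set.not_subset.1 hn
    obtain ⟨t, ht, w, hw, htX, hwX, htw⟩ := hA ((Bᶜ \ {x}) \ Q) ⟨s, hs.1, hs, hsQ⟩
      ⟨l, fun h => hbd l h hl, fun h => h.2 hlQ⟩
    have hwx : w = x := by
      by_contra hwx
      have hwQ : w ∈ Q := by
        by_contra h
        exact hwX ⟨⟨hw, hwx⟩, h⟩
      exact htX.2 (hcl w hwQ t htX.1 htw.symm)
    subst hwx
    apply htX.2
    have hge : w.1.2 ≤ t.1.2 ∧ ¬ (w.1.1 = t.1.1 ∧ t.1.2 ≤ w.1.2) := by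
      rcases lat_four (adj_lat Γ htw.symm) with h | h | h | h
      · rw [h]; simp
      · rw [h]; simp; omega
      · rw [h]; simp
      · exfalso
        apply ht
        have : t = p := Subtype.ext (by rw [h]; exact Prod.ext hx1 (by simp [hx2]))
        rw [this]; exact hp
    refine col_up hcl hb t fun z h1 h2 => ⟨fun hz => ?_, fun hz => ?_⟩
    · have := htop z hz; omega
    · have hz : z = w := hz
      subst hz
      exact hge.2 ⟨h1, h2⟩
  rw [← hQ.antisymm this]
  exact hc

theorem climb {M : SimpleGraph ↥Γ.verts → Prop} {k : ℕ}
    (hM : ∀ B : Set ↥Γ.verts, B.ncard = k → ∀ T, Resp Γ.graph T B → M T) (n : ℕ) :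
    ∀ (T : SimpleGraph ↥Γ.verts) (B : Set ↥Γ.verts) (p : ↥Γ.verts), Resp Γ.graph T B →
      B.ncard = k → p ∈ B → (∀ q ∈ B, q.1.2 ≤ p.1.2) → (∀ q ∈ B, q.1 ∉ Γ.boundary) →
      {q : ↥Γ.verts | p.1.2 < q.1.2}.ncard ≤ n →
      ∃ T' B', Reach (St Γ.graph M) (10 * n) T T' ∧ Resp Γ.graph T' B' ∧ B'.ncard = k ∧
        (∃ v ∈ B', v.1 ∈ Γ.boundary) ∧ (∃ v, v ∉ B' ∧ v.1 ∈ Γ.boundary) := by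
  have := verts_finite Γ
  induction n with
  | zero =>
    intro T B p hT hk hp htop hbd hn
    exfalso
    obtain ⟨x, hx, -⟩ := exists_up Γ (hbd p hp)
    have h0 := (Set.ncard_eq_zero (Set.toFinite _)).1 (Nat.le_zero.1 hn)
    have : x ∈ {q : ↥Γ.verts | p.1.2 < q.1.2} := by
      change p.1.2 < x.1.2
      rw [hx]; simp
    rw [h0] at this
    exact this
  | succ n ih =>
    intro T B p hT hk hp htop hbd hn
    obtain ⟨x, hx, hpx⟩ := exists_up Γ (hbd p hp)
    have hx1 : x.1.1 = p.1.1 := by rw [hx]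
    have hx2 : x.1.2 = p.1.2 + 1 := by rw [hx]
    have hxB : x ∉ B := fun h => by have := htop x h; omega
    obtain ⟨l, hl, hlx⟩ := exists_bd_ne Γ x
    have hlB : l ∉ B := fun h => hbd l h hl
    obtain ⟨T', B', r, hT', hk', hxB', hsub⟩ := swap (deg_le Γ) two_conn hM hk hT hp hxB hpx
      (fun u hu hux => by
        have h1 := htop u hu
        rcases lat_four (adj_lat Γ hux.symm) with h | h | h | h
        · rw [h] at h1; simp only at h1; omega
        · rw [h] at h1; simp only at h1; omega
        · rw [h] at h1; simp only at h1; omega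
        · exact Subtype.ext (by rw [h]; exact Prod.ext hx1 (by simp [hx2])))
      ⟨l, hlB, hlx⟩
      (top_conn (hT.cA.congr fun u _ v _ h => hT.le h) hp hx hxB htop hbd)
    by_cases hxb : x.1 ∈ Γ.boundary
    · refine ⟨T', B', r.mono (by omega), hT', hk', ⟨x, hxB', hxb⟩, l, fun h => ?_, hl⟩
      rcases hsub h with h | h
      · exact hlx h
      · exact hlB h
    · obtain ⟨T'', B'', r', h1, h2, h3, h4⟩ := ih T' B' x hT' hk' hxB' (fun q hq => by
          rcases hsub hq with rfl | h
          · exact le_rfl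
          · have := htop q h; omega)
        (fun q hq => by
          rcases hsub hq with rfl | h
          · exact hxb
          · exact hbd q h)
        (by
          have : {q : ↥Γ.verts | x.1.2 < q.1.2}.ncard < {q : ↥Γ.verts | p.1.2 < q.1.2}.ncard := by
            refine Set.ncard_lt_ncard ⟨fun q hq => ?_, fun h => ?_⟩ (Set.toFinite _)
            · change p.1.2 < q.1.2
              have : x.1.2 < q.1.2 := hq
              omega
            · have h5 : x.1.2 < x.1.2 := h (a := x) (show p.1.2 < x.1.2 by omega)
              omega
          omega)
      exact ⟨T'', B'', (r.trans r').mono (by omega), h1, h2, h3, h4⟩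

theorem climb' {M : SimpleGraph ↥Γ.verts → Prop} {k : ℕ}
    (hM : ∀ B : Set ↥Γ.verts, B.ncard = k → ∀ T, Resp Γ.graph T B → M T)
    (T : SimpleGraph ↥Γ.verts) (B : Set ↥Γ.verts) (hT : Resp Γ.graph T B)
    (hk : B.ncard = k) (hbd : ∀ q ∈ B, q.1 ∉ Γ.boundary) :
      ∃ T' B', Reach (St Γ.graph M) (10 * Nat.card ↥Γ.verts) T T' ∧ Resp Γ.graph T' B' ∧
        B'.ncard = k ∧
        (∃ v ∈ B', v.1 ∈ Γ.boundary) ∧ (∃ v, v ∉ B' ∧ v.1 ∈ Γ.boundary) := by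
  have := verts_finite Γ
  obtain ⟨u, hu, -⟩ := hT.cross
  obtain ⟨p, hp, hmax⟩ := Set.exists_max_image B (fun q => q.1.2) (Set.toFinite _) ⟨u, hu⟩
  refine climb hM _ T B p hT hk hp hmax hbd ?_
  rw [← Set.ncard_univ]
  exact Set.ncard_le_ncard (Set.subset_univ _) (Set.toFinite _)

end geom

end BudAux

/-- There is a constant `C > 0` such that, on any simple grid graph, at most
`C·n` BUD steps transform any `T ∈ B_2^{a,b}(G)` into a tree whose two split
pieces each contain a vertex of the boundary `∂G`. -/
theorem stmt9 : ∃ C : ℝ, 0 < C ∧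
    ∀ (Γ : SimpleGridGraph) (a b : ℕ), a + b = Nat.card ↥Γ.verts →
    ∀ T : SimpleGraph ↥Γ.verts, MemB2 Γ.graph a b T →
      ∃ (m : ℕ) (c : ℕ → SimpleGraph ↥Γ.verts),
        (m : ℝ) ≤ C * (Nat.card ↥Γ.verts) ∧ c 0 = T ∧
        (∀ i < m, BUDStep2 Γ.graph a b (c i) (c (i + 1))) ∧
        MemB2 Γ.graph a b (c m) ∧
        ∃ g ∈ (c m).edgeSet, ∃ A : Set ↥Γ.verts,
          (∀ v w, ((c m).deleteEdges {g}).Reachable v w ↔ (v ∈ A ↔ w ∈ A)) ∧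
          Nat.card ↥A = a ∧ Nat.card ↥(Aᶜ) = b ∧
          (∃ v ∈ A, (v : ℤ × ℤ) ∈ Γ.boundary) ∧
          (∃ v ∈ Aᶜ, (v : ℤ × ℤ) ∈ Γ.boundary) := by
  refine ⟨10, by norm_num, ?_⟩
  intro Γ a b hab T hT
  have hfin := BudAux.verts_finite Γ
  obtain ⟨hle, ht, g, hg, A, hA, ha, hb⟩ := hT
  have hR : BudAux.Resp Γ.graph T A := BudAux.Resp.of_split hle ht hg hA
  by_cases h1 : ∃ v ∈ A, (v : ℤ × ℤ) ∈ Γ.boundary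
  · by_cases h2 : ∃ v ∈ Aᶜ, (v : ℤ × ℤ) ∈ Γ.boundary
    · exact ⟨0, fun _ => T, by simp, rfl, by simp, ⟨hle, ht, g, hg, A, hA, ha, hb⟩,
        g, hg, A, hA, ha, hb, h1, h2⟩
    · have hc : ∀ B : Set ↥Γ.verts, B.ncard = b → Bᶜ.ncard = a := by
        intro B hB
        have := Set.ncard_add_ncard_compl B
        omega
      have hM : ∀ B : Set ↥Γ.verts, B.ncard = b → ∀ T, BudAux.Resp Γ.graph T B →
          MemB2 Γ.graph a b T := by
        intro B hB T hT
        have := hT.compl.memB2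
        rwa [compl_compl, hc B hB, hB] at this
      obtain ⟨T', B', r, hT', hk', hb1, hb2⟩ := BudAux.climb' hM T Aᶜ hR.compl hb
        (fun q hq hq' => h2 ⟨q, hq, hq'⟩)
      obtain ⟨m, hm, c, hc0, hcm, hs⟩ := r.seq
      refine ⟨m, c, by exact_mod_cast hm, hc0, hs, hcm ▸ hM B' hk' T' hT', ?_⟩
      rw [hcm]
      obtain ⟨u, hu, v, hv, huv⟩ := hT'.compl.cross
      obtain ⟨v1, hv1, hv1'⟩ := hb2
      refine ⟨s(u, v), huv, B'ᶜ, hT'.compl.reach_iff hu hv huv, hc B' hk', ?_, ⟨v1, hv1, hv1'⟩, ?_⟩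
      · rw [compl_compl]; exact hk'
      · rw [compl_compl]; exact hb1
  · have hc : ∀ B : Set ↥Γ.verts, B.ncard = a → Bᶜ.ncard = b := by
      intro B hB
      have := Set.ncard_add_ncard_compl B
      omega
    have hM : ∀ B : Set ↥Γ.verts, B.ncard = a → ∀ T, BudAux.Resp Γ.graph T B →
        MemB2 Γ.graph a b T := by
      intro B hB T hT
      have := hT.memB2
      rwa [hc B hB, hB] at this
    obtain ⟨T', B', r, hT', hk', hb1, hb2⟩ := BudAux.climb' hM T A hR ha
      (fun q hq hq' => h1 ⟨q, hq, hq'⟩)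
    obtain ⟨m, hm, c, hc0, hcm, hs⟩ := r.seq
    refine ⟨m, c, by exact_mod_cast hm, hc0, hs, hcm ▸ hM B' hk' T' hT', ?_⟩
    rw [hcm]
    obtain ⟨u, hu, v, hv, huv⟩ := hT'.cross
    exact ⟨s(u, v), huv, B', hT'.reach_iff hu hv huv, hk', hc B' hk', hb1, hb2⟩
end
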